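/- Let L be a C^k (k ≥ 2) Tonelli Lagrangian on T𝕋ⁿ without conjugate points, with Euler–Lagrange flow (φ_t). Fix T > 0 and r ∈ ℤⁿ. Then: (1) for every x ∈ ℝⁿ there is a unique extremal curve c_x : ℝ → ℝⁿ with c_x(0) = x and c_x(s+T) = c_x(s) + r for all s ∈ ℝ; (2) the map X : ℝⁿ → ℝⁿ, X(x) = c_x'(0), is ℤⁿ-periodic and of class C^{k−1}; (3) the action ∫_0^T L(c_x(s), c_x'(s)) ds does not depend on x; (4) the set Γ_{T,r} = {(x, X(x)) : x ∈ ℝⁿ} is invariant under (φ_t) and every point of Γ_{T,r} satisfies φ_T(x, X(x)) = (x + r, X(x)); (5) the map x ↦ ∂L/∂v(x, X(x)) has a symmetric derivative (Jacobian matrix) at every point, i.e., the Legendre image of Γ_{T,r} is a Lagrangian graph. -/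

import Mathlib

open MeasureTheory
open scoped NNReal

noncomputable section

abbrev E (n : ℕ) : Type := Fin n → ℝ

/-- The vector of `ℝⁿ` whose coordinates are the integers `m i`. -/
def intVec {n : ℕ} (m : Fin n → ℤ) : E n := fun i => (m i : ℝ)

/-- A Tonelli Lagrangian on `T𝕋ⁿ`, identified with a `ℤⁿ`-periodic (in `x`) function
on `ℝⁿ × ℝⁿ` which is `Cᵏ`, uniformly superlinear in `v` and with positive definite
fiberwise Hessian. -/
structure IsTonelliLagrangian (n : ℕ) (k : ℕ∞) (L : E n × E n → ℝ) : Prop where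
  smooth : ContDiff ℝ k L
  periodic : ∀ (x v : E n) (m : Fin n → ℤ), L (x + intVec m, v) = L (x, v)
  superlinear : ∀ C : ℝ, ∃ R : ℝ, ∀ (x v : E n), R ≤ ‖v‖ → C * ‖v‖ ≤ L (x, v)
  posdef : ∀ (x v w : E n), w ≠ 0 →
    0 < fderiv ℝ (fun v' => fderiv ℝ (fun v'' => L (x, v'')) v' w) v w

/-- Partial differential of `L` in the fiber (velocity) direction. -/
def partialV (n : ℕ) (L : E n × E n → ℝ) (x v : E n) : E n →L[ℝ] ℝ :=
  fderiv ℝ (fun v' => L (x, v')) v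

/-- Partial differential of `L` in the base (position) direction. -/
def partialX (n : ℕ) (L : E n × E n → ℝ) (x v : E n) : E n →L[ℝ] ℝ :=
  fderiv ℝ (fun x' => L (x', v)) x

/-- A `C²` curve satisfying the Euler–Lagrange equation
`d/dt (∂L/∂v(γ, γ')) = ∂L/∂x(γ, γ')`. -/
def IsExtremal (n : ℕ) (L : E n × E n → ℝ) (γ : ℝ → E n) : Prop :=
  ContDiff ℝ 2 γ ∧
  ∀ t : ℝ, HasDerivAt (fun s => partialV n L (γ s) (deriv γ s))
    (partialX n L (γ t) (deriv γ t)) t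

/-- `φ` is the (complete, `C^{k-1}`) Euler–Lagrange flow of `L` on `ℝⁿ × ℝⁿ`:
`φ t (x,v) = (γ t, γ' t)` where `γ` is the extremal curve with `(γ 0, γ' 0) = (x, v)`. -/
def IsELFlow (n : ℕ) (k : ℕ) (L : E n × E n → ℝ)
    (φ : ℝ → E n × E n → E n × E n) : Prop :=
  ContDiff ℝ ((k - 1 : ℕ) : ℕ∞) (fun p : ℝ × (E n × E n) => φ p.1 p.2) ∧
  (∀ z : E n × E n, φ 0 z = z) ∧
  ∀ x v : E n, IsExtremal n L (fun t => (φ t (x, v)).1) ∧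
    ∀ t : ℝ, (φ t (x, v)).2 = deriv (fun s => (φ s (x, v)).1) t

/-- The flow `φ` has no conjugate points: for `t ≠ 0` the image of the vertical
subspace `{0} × ℝⁿ` under `Dφ_t(z)` meets `{0} × ℝⁿ` only in `0`. -/
def NoConjugatePoints (n : ℕ) (φ : ℝ → E n × E n → E n × E n) : Prop :=
  ∀ (z : E n × E n) (t : ℝ), t ≠ 0 → ∀ w : E n,
    (fderiv ℝ (φ t) z (0, w)).1 = 0 → w = 0

/-- The absolutely continuous curve starting at `x` with derivative `g`. -/
def curveOf (n : ℕ) (x : E n) (g : ℝ → E n) : ℝ → E n :=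
  fun s => x + ∫ u in (0:ℝ)..s, g u

/-- `Acost n L t x y` = the infimum of the Lagrangian action over all absolutely
continuous curves `c : [0,t] → ℝⁿ` with `c 0 = x` and `c t = y`. -/
def Acost (n : ℕ) (L : E n × E n → ℝ) (t : ℝ) (x y : E n) : ℝ :=
  sInf { A : ℝ | ∃ g : ℝ → E n,
    IntervalIntegrable g volume 0 t ∧
    curveOf n x g t = y ∧
    IntervalIntegrable (fun s => L (curveOf n x g s, g s)) volume 0 t ∧
    A = ∫ s in (0:ℝ)..t, L (curveOf n x g s, g s) }

section Auxiliary

open Set Filter Topology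

section FibreConvexity

variable {n : ℕ} {k : ℕ} {L : E n × E n → ℝ}

theorem IsTonelliLagrangian.contDiff_two (hk : 2 ≤ k) (hL : IsTonelliLagrangian n (k : ℕ∞) L) :
    ContDiff ℝ 2 L :=
  hL.smooth.of_le (WithTop.coe_le_coe.2 (by exact_mod_cast hk : ((2 : ℕ) : ℕ∞) ≤ k))

theorem partialV_eq (hL : ContDiff ℝ 2 L) (x v : E n) :
    partialV n L x v = (fderiv ℝ L (x, v)).comp (ContinuousLinearMap.inr ℝ (E n) (E n)) :=
  ((hL.differentiable (by norm_num) (x, v)).hasFDerivAt.comp v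
    (hasFDerivAt_prodMk_right x v)).fderiv

theorem partialX_eq (hL : ContDiff ℝ 2 L) (x v : E n) :
    partialX n L x v = (fderiv ℝ L (x, v)).comp (ContinuousLinearMap.inl ℝ (E n) (E n)) :=
  ((hL.differentiable (by norm_num) (x, v)).hasFDerivAt.comp x
    (hasFDerivAt_prodMk_left x v)).fderiv

theorem fderiv_lagrangian_apply (hL : ContDiff ℝ 2 L) (z w : E n × E n) :
    fderiv ℝ L z w = partialX n L z.1 z.2 w.1 + partialV n L z.1 z.2 w.2 := by
  rw [partialV_eq hL, partialX_eq hL]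
  simp only [ContinuousLinearMap.comp_apply, ContinuousLinearMap.inl_apply,
    ContinuousLinearMap.inr_apply, ← map_add]
  simp

theorem contDiff_partialV (hL : ContDiff ℝ 2 L) :
    ContDiff ℝ 1 (fun z : E n × E n => partialV n L z.1 z.2) := by
  simp only [partialV_eq hL]
  exact (hL.fderiv_right (m := 1) (by norm_num)).clm_comp contDiff_const

theorem contDiff_partialX (hL : ContDiff ℝ 2 L) :
    ContDiff ℝ 1 (fun z : E n × E n => partialX n L z.1 z.2) := by
  simp only [partialX_eq hL]
  exact (hL.fderiv_right (m := 1) (by norm_num)).clm_comp contDiff_const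

/-- The fibrewise Hessian of `L`, as a quadratic form. -/
def fibreHessian (L : E n × E n → ℝ) (z : E n × E n) (w : E n) : ℝ :=
  fderiv ℝ (fun z : E n × E n => partialV n L z.1 z.2) z (0, w) w

theorem hasFDerivAt_partialV_apply (hL : ContDiff ℝ 2 L) (x v w : E n) :
    HasFDerivAt (fun v' => partialV n L x v' w)
      (((fderiv ℝ (fun z : E n × E n => partialV n L z.1 z.2) (x, v)).comp
        (ContinuousLinearMap.inr ℝ (E n) (E n))).flip w) v := by
  have h := ((contDiff_partialV hL).differentiable (by norm_num) (x, v)).hasFDerivAt.comp v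
    (hasFDerivAt_prodMk_right x v)
  simpa using h.clm_apply (hasFDerivAt_const w v)

theorem fibreHessian_pos (hL : ContDiff ℝ 2 L)
    (hpos : ∀ (x v w : E n), w ≠ 0 →
      0 < fderiv ℝ (fun v' => fderiv ℝ (fun v'' => L (x, v'')) v' w) v w)
    (z : E n × E n) {w : E n} (hw : w ≠ 0) : 0 < fibreHessian L z w := by
  have h := hpos z.1 z.2 w hw
  rw [show (fun v' => fderiv ℝ (fun v'' => L (z.1, v'')) v' w) =
    fun v' => partialV n L z.1 v' w from rfl, (hasFDerivAt_partialV_apply hL z.1 z.2 w).fderiv] at h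
  simpa [fibreHessian] using h

theorem fibreHessian_smul (z : E n × E n) (c : ℝ) (w : E n) :
    fibreHessian L z (c • w) = c ^ 2 * fibreHessian L z w := by
  have : ((0 : E n), c • w) = c • ((0 : E n), w) := by simp
  simp only [fibreHessian, this, map_smul, smul_apply, smul_eq_mul]
  ring

theorem continuous_fibreHessian (hL : ContDiff ℝ 2 L) :
    Continuous (fun p : (E n × E n) × E n => fibreHessian L p.1 p.2) := by
  have h := (contDiff_partialV hL).continuous_fderiv (by norm_num)
  unfold fibreHessian
  fun_prop

theorem hasDerivAt_partialV_line (hL : ContDiff ℝ 2 L) (x v d : E n) (s : ℝ) :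
    HasDerivAt (fun s : ℝ => partialV n L x (v + s • d) d) (fibreHessian L (x, v + s • d) d) s := by
  have h1 : HasDerivAt (fun s : ℝ => v + s • d) d s := by
    simpa using ((hasDerivAt_id s).smul_const d).const_add v
  have := (hasFDerivAt_partialV_apply hL x (v + s • d) d).comp_hasDerivAt s h1
  exact this.congr_deriv (by simp [fibreHessian])

/-- Mean value formula for the fibre derivative along a segment. -/
theorem exists_partialV_sub_eq (hL : ContDiff ℝ 2 L) (x v w : E n) :
    ∃ s ∈ Ioo (0 : ℝ) 1, partialV n L x w (w - v) - partialV n L x v (w - v) =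
      fibreHessian L (x, v + s • (w - v)) (w - v) := by
  obtain ⟨s, hs, h⟩ := exists_hasDerivAt_eq_slope
    (fun s : ℝ => partialV n L x (v + s • (w - v)) (w - v)) _ zero_lt_one
    (fun s _ => (hasDerivAt_partialV_line hL x v (w - v) s).continuousAt.continuousWithinAt)
    (fun s _ => hasDerivAt_partialV_line hL x v (w - v) s)
  exact ⟨s, hs, by simpa using h.symm⟩

theorem partialV_injective (hL : ContDiff ℝ 2 L)
    (hpos : ∀ (x v w : E n), w ≠ 0 →
      0 < fderiv ℝ (fun v' => fderiv ℝ (fun v'' => L (x, v'')) v' w) v w)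
    (x : E n) : Function.Injective (partialV n L x) := by
  intro v w h
  by_contra hne
  obtain ⟨s, -, hs⟩ := exists_partialV_sub_eq hL x v w
  have := fibreHessian_pos hL hpos (x, v + s • (w - v)) (sub_ne_zero.2 (Ne.symm hne))
  rw [h, sub_self] at hs
  exact this.ne hs

/-- Weierstrass inequality: `L` lies above its fibrewise tangent planes. -/
theorem partialV_apply_sub_le (hL : ContDiff ℝ 2 L)
    (hpos : ∀ (x v w : E n), w ≠ 0 →
      0 < fderiv ℝ (fun v' => fderiv ℝ (fun v'' => L (x, v'')) v' w) v w)
    (x v w : E n) : partialV n L x v (w - v) ≤ L (x, w) - L (x, v) := by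
  have hd : ∀ s : ℝ, HasDerivAt (fun s : ℝ => L (x, v + s • (w - v)))
      (partialV n L x (v + s • (w - v)) (w - v)) s := by
    intro s
    have h1 : HasDerivAt (fun s : ℝ => (x, v + s • (w - v))) ((0 : E n), w - v) s :=
      (hasDerivAt_const s x).prodMk
        (by simpa using ((hasDerivAt_id s).smul_const (w - v)).const_add v)
    have := (hL.differentiable (by norm_num) (x, v + s • (w - v))).hasFDerivAt.comp_hasDerivAt s h1
    exact this.congr_deriv (by simp [partialV_eq hL])
  have hmono : Monotone fun s : ℝ => partialV n L x (v + s • (w - v)) (w - v) := by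
    refine monotone_of_deriv_nonneg
      (fun s => (hasDerivAt_partialV_line hL x v (w - v) s).differentiableAt) fun s => ?_
    rw [(hasDerivAt_partialV_line hL x v (w - v) s).deriv]
    rcases eq_or_ne (w - v) 0 with h0 | h0
    · simp [h0, fibreHessian]
    · exact (fibreHessian_pos hL hpos _ h0).le
  obtain ⟨s, hs, h⟩ := exists_hasDerivAt_eq_slope _ _ zero_lt_one
    (fun s _ => (hd s).continuousAt.continuousWithinAt) (fun s _ => hd s)
  have := hmono hs.1.le
  simp only [zero_smul, add_zero, h, one_smul, sub_zero, div_one, add_sub_cancel] at this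
  exact this

/-- Uniform strong monotonicity of the fibre derivative on bounded sets. -/
theorem exists_strong_monotone (hL : ContDiff ℝ 2 L)
    (hpos : ∀ (x v w : E n), w ≠ 0 →
      0 < fderiv ℝ (fun v' => fderiv ℝ (fun v'' => L (x, v'')) v' w) v w) (R : ℝ) :
    ∃ a > 0, ∀ x ∈ Metric.closedBall (0 : E n) R, ∀ v ∈ Metric.closedBall (0 : E n) R,
      ∀ w ∈ Metric.closedBall (0 : E n) R,
      a * ‖w - v‖ ^ 2 ≤ partialV n L x w (w - v) - partialV n L x v (w - v) := by
  let K : Set ((E n × E n) × E n) :=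
    (Metric.closedBall 0 R ×ˢ Metric.closedBall 0 R) ×ˢ Metric.sphere 0 1
  have hK : IsCompact K :=
    ((isCompact_closedBall _ _).prod (isCompact_closedBall _ _)).prod (isCompact_sphere _ _)
  have hpt : ∀ p ∈ K, 0 < fibreHessian L p.1 p.2 := fun p hp =>
    fibreHessian_pos hL hpos p.1
      (ne_zero_of_mem_unit_sphere (⟨p.2, hp.2⟩ : Metric.sphere (0 : E n) 1))
  obtain ⟨a, ha, hKa⟩ : ∃ a > 0, ∀ p ∈ K, a ≤ fibreHessian L p.1 p.2 := by
    rcases K.eq_empty_or_nonempty with h | h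
    · exact ⟨1, one_pos, by simp [h]⟩
    · obtain ⟨p, hp, hmin⟩ := hK.exists_isMinOn h (continuous_fibreHessian hL).continuousOn
      exact ⟨_, hpt p hp, fun q hq => hmin hq⟩
  refine ⟨a, ha, fun x hx v hv w hw => ?_⟩
  obtain ⟨s, hs, h⟩ := exists_partialV_sub_eq hL x v w
  rw [h]
  rcases eq_or_ne (w - v) 0 with h0 | h0
  · simp [h0, fibreHessian]
  have hmem : v + s • (w - v) ∈ Metric.closedBall (0 : E n) R :=
    (convex_closedBall (0 : E n) R).add_smul_sub_mem hv hw ⟨hs.1.le, hs.2.le⟩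
  have hn0 : ‖w - v‖ ≠ 0 := norm_ne_zero_iff.2 h0
  have := hKa ((x, v + s • (w - v)), ‖w - v‖⁻¹ • (w - v))
    ⟨⟨hx, hmem⟩, by simp [norm_smul, hn0]⟩
  have hw' : w - v = ‖w - v‖ • (‖w - v‖⁻¹ • (w - v)) := by rw [smul_smul]; simp [hn0]
  rw [hw', fibreHessian_smul, norm_smul, norm_smul]
  simp only [norm_norm, norm_inv, inv_mul_cancel₀ hn0, mul_one]
  rw [mul_comm]
  refine mul_le_mul_of_nonneg_left ?_ (sq_nonneg _)
  rw [← hw']; exact this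

end FibreConvexity

section Uniqueness

/-- Two-sided Grönwall lemma for a vanishing initial condition. -/
theorem eq_zero_of_norm_deriv_le_mul_norm {F : Type*} [NormedAddCommGroup F] [NormedSpace ℝ F]
    {f f' : ℝ → F} {K b : ℝ} (hf : ∀ t, HasDerivAt f (f' t) t) (h0 : f 0 = 0)
    (hK : ∀ t, |t| ≤ b → ‖f' t‖ ≤ K * ‖f t‖) {t : ℝ} (ht : |t| ≤ b) : f t = 0 := by
  have key : ∀ g g' : ℝ → F, (∀ t, HasDerivAt g (g' t) t) → g 0 = 0 →
      (∀ t, |t| ≤ b → ‖g' t‖ ≤ K * ‖g t‖) → ∀ t ∈ Icc 0 b, g t = 0 := by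
    intro g g' hg hg0 hgK
    refine eq_zero_of_abs_deriv_le_mul_abs_self_of_eq_zero_right (K := K) (f' := g')
      (fun t _ => (hg t).continuousAt.continuousWithinAt)
      (fun t _ => (hg t).hasDerivWithinAt) hg0 fun t ht => hgK t ?_
    rw [abs_of_nonneg ht.1]
    exact ht.2.le
  rcases le_total 0 t with h | h
  · exact key f f' hf h0 hK t ⟨h, (le_abs_self t).trans ht⟩
  · have := key (fun s => f (-s)) (fun s => -f' (-s))
      (fun s => ((hf (-s)).scomp s (hasDerivAt_neg s)).congr_deriv (by simp)) (by simpa using h0)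
      (fun s hs => by simpa using hK (-s) (by simpa using hs)) (-t)
      ⟨by linarith, (neg_le_abs t).trans ht⟩
    simpa using this

variable {n : ℕ} {k : ℕ} {L : E n × E n → ℝ} {γ γ₁ γ₂ : ℝ → E n}

theorem IsExtremal.hasDerivAt (h : IsExtremal n L γ) (t : ℝ) : HasDerivAt γ (deriv γ t) t :=
  (h.1.differentiable (by norm_num) t).hasDerivAt

theorem IsExtremal.continuous_deriv (h : IsExtremal n L γ) : Continuous (deriv γ) :=
  h.1.continuous_deriv (by norm_num)

/-- An extremal curve is determined by its initial position and velocity. -/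
theorem IsExtremal.eq_of_initial (hk : 2 ≤ k) (hL : IsTonelliLagrangian n (k : ℕ∞) L)
    (h₁ : IsExtremal n L γ₁) (h₂ : IsExtremal n L γ₂) (h0 : γ₁ 0 = γ₂ 0)
    (h0' : deriv γ₁ 0 = deriv γ₂ 0) : γ₁ = γ₂ := by
  have hL2 := hL.contDiff_two hk
  funext t₀
  obtain ⟨R, hR⟩ := (isCompact_Icc (a := -|t₀|) (b := |t₀|)).exists_bound_of_continuousOn
    (f := fun t => ((γ₁ t, deriv γ₁ t), (γ₂ t, deriv γ₂ t)))
    ((h₁.1.continuous.prodMk h₁.continuous_deriv).prodMk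
      (h₂.1.continuous.prodMk h₂.continuous_deriv)).continuousOn
  obtain ⟨a, ha, hmono⟩ := exists_strong_monotone hL2 hL.posdef R
  obtain ⟨C, hC⟩ := ((contDiff_partialV hL2).locallyLipschitz.locallyLipschitzOn
    (s := Metric.closedBall 0 R)).exists_lipschitzOnWith_of_compact (isCompact_closedBall _ _)
  obtain ⟨D, hD⟩ := ((contDiff_partialX hL2).locallyLipschitz.locallyLipschitzOn
    (s := Metric.closedBall 0 R)).exists_lipschitzOnWith_of_compact (isCompact_closedBall _ _)
  let f : ℝ → E n × (E n →L[ℝ] ℝ) := fun t => (γ₁ t - γ₂ t,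
    partialV n L (γ₁ t) (deriv γ₁ t) - partialV n L (γ₂ t) (deriv γ₂ t))
  let B : ℝ := (1 + C) / a
  have hf0 : f t₀ = 0 := by
    refine eq_zero_of_norm_deriv_le_mul_norm (f := f) (b := |t₀|) (K := max B (D * max 1 B))
      (fun t => ((h₁.hasDerivAt t).sub (h₂.hasDerivAt t)).prodMk ((h₁.2 t).sub (h₂.2 t)))
      (by simp [f, h0, h0']) (fun t ht => ?_) le_rfl
    have hb := hR t (abs_le.1 ht)
    simp only [Prod.norm_def, max_le_iff] at hb
    obtain ⟨⟨hx₁, hv₁⟩, hx₂, hv₂⟩ := hb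
    have hf1 : ‖γ₁ t - γ₂ t‖ ≤ ‖f t‖ := norm_fst_le (f t)
    have hf2 : ‖partialV n L (γ₁ t) (deriv γ₁ t) - partialV n L (γ₂ t) (deriv γ₂ t)‖ ≤ ‖f t‖ :=
      norm_snd_le (f t)
    have hball : ∀ x v : E n, ‖x‖ ≤ R → ‖v‖ ≤ R → (x, v) ∈ Metric.closedBall (0 : E n × E n) R :=
      fun x v hx hv => by simp [Prod.norm_def, hx, hv]
    have hd : ‖deriv γ₁ t - deriv γ₂ t‖ ≤ B * ‖f t‖ := by
      have h1 := hmono (γ₁ t) (by simpa using hx₁) (deriv γ₂ t) (by simpa using hv₂)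
        (deriv γ₁ t) (by simpa using hv₁)
      have h2 := hC.dist_le_mul _ (hball _ _ hx₂ hv₂) _ (hball _ _ hx₁ hv₂)
      rw [dist_eq_norm, dist_eq_norm] at h2
      simp only [Prod.mk_sub_mk, sub_self, Prod.norm_mk, norm_zero] at h2
      rw [max_eq_left (norm_nonneg _), norm_sub_rev (γ₂ t)] at h2
      set d := deriv γ₁ t - deriv γ₂ t
      have h3 : a * ‖d‖ ^ 2 ≤ (1 + C) * ‖f t‖ * ‖d‖ := by
        calc a * ‖d‖ ^ 2 ≤ _ := h1
          _ = (partialV n L (γ₁ t) (deriv γ₁ t) - partialV n L (γ₂ t) (deriv γ₂ t)) d +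
            (partialV n L (γ₂ t) (deriv γ₂ t) - partialV n L (γ₁ t) (deriv γ₂ t)) d := by
              simp
          _ ≤ ‖f t‖ * ‖d‖ + C * ‖f t‖ * ‖d‖ := by
              gcongr
              · exact ((Real.le_norm_self _).trans (ContinuousLinearMap.le_opNorm _ _)).trans
                  (by gcongr)
              · refine ((Real.le_norm_self _).trans (ContinuousLinearMap.le_opNorm _ _)).trans ?_
                gcongr
                exact h2.trans (by gcongr)
          _ = _ := by ring
      rcases (norm_nonneg d).eq_or_lt with h4 | h4
      · rw [← h4]; positivity
      · rw [div_mul_eq_mul_div, le_div_iff₀ ha]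
        refine le_of_mul_le_mul_right ?_ h4
        linarith
    have hX := hD.dist_le_mul _ (hball _ _ hx₁ hv₁) _ (hball _ _ hx₂ hv₂)
    rw [dist_eq_norm, dist_eq_norm] at hX
    simp only [Prod.mk_sub_mk] at hX
    refine (Prod.norm_mk _ _).trans_le (max_le ?_ ?_)
    · exact hd.trans (by gcongr; exact le_max_left _ _)
    · refine hX.trans ?_
      calc (D : ℝ) * ‖(γ₁ t - γ₂ t, deriv γ₁ t - deriv γ₂ t)‖ ≤ D * (max 1 B * ‖f t‖) := by
            gcongr
            refine max_le (hf1.trans ?_) (hd.trans ?_)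
            · exact le_mul_of_one_le_left (norm_nonneg _) (le_max_left _ _)
            · gcongr; exact le_max_right _ _
        _ ≤ _ := by rw [← mul_assoc]; gcongr; exact le_max_right _ _
  exact sub_eq_zero.1 (congrArg Prod.fst hf0)

theorem IsExtremal.comp_add_const (h : IsExtremal n L γ) (s : ℝ) :
    IsExtremal n L fun t => γ (t + s) := by
  refine ⟨h.1.comp (contDiff_id.add contDiff_const), fun t => ?_⟩
  simp only [deriv_comp_add_const]
  exact HasDerivAt.comp_add_const t s (h.2 (t + s))

theorem IsTonelliLagrangian.partialV_add (hL : IsTonelliLagrangian n (k : ℕ∞) L) (x v : E n)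
    (m : Fin n → ℤ) : partialV n L (x + intVec m) v = partialV n L x v := by
  simp only [partialV, hL.periodic]

theorem IsTonelliLagrangian.partialX_add (hL : IsTonelliLagrangian n (k : ℕ∞) L) (x v : E n)
    (m : Fin n → ℤ) : partialX n L (x + intVec m) v = partialX n L x v := by
  simp only [partialX]
  rw [← fderiv_comp_add_right]
  simp only [hL.periodic]

theorem IsExtremal.add_intVec (hL : IsTonelliLagrangian n (k : ℕ∞) L) (h : IsExtremal n L γ)
    (m : Fin n → ℤ) : IsExtremal n L fun t => γ t + intVec m := by
  refine ⟨h.1.add contDiff_const, fun t => ?_⟩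
  simp only [deriv_add_const, hL.partialV_add, hL.partialX_add]
  exact h.2 t

end Uniqueness

section Flow

variable {n : ℕ} {k : ℕ} {L : E n × E n → ℝ} {φ : ℝ → E n × E n → E n × E n}

theorem IsELFlow.hasDerivAt_fst (hφ : IsELFlow n k L φ) (z : E n × E n) (t : ℝ) :
    HasDerivAt (fun s => (φ s z).1) (φ t z).2 t := by
  rw [(hφ.2.2 z.1 z.2).2 t]
  exact (hφ.2.2 z.1 z.2).1.hasDerivAt t

theorem IsELFlow.contDiff_one (hk : 2 ≤ k) (hφ : IsELFlow n k L φ) :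
    ContDiff ℝ 1 (fun p : ℝ × (E n × E n) => φ p.1 p.2) :=
  hφ.1.of_le (WithTop.coe_le_coe.2 (by exact_mod_cast (by omega) : ((1 : ℕ) : ℕ∞) ≤ (k - 1 : ℕ)))

/-- Extremal curves are the projections of orbits of the Euler–Lagrange flow. -/
theorem IsELFlow.apply_eq_of_isExtremal (hk : 2 ≤ k) (hL : IsTonelliLagrangian n (k : ℕ∞) L)
    (hφ : IsELFlow n k L φ) {γ : ℝ → E n} (hγ : IsExtremal n L γ) (t : ℝ) :
    φ t (γ 0, deriv γ 0) = (γ t, deriv γ t) := by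
  obtain ⟨he, hv⟩ := hφ.2.2 (γ 0) (deriv γ 0)
  have h : (fun s => (φ s (γ 0, deriv γ 0)).1) = γ := by
    refine he.eq_of_initial hk hL hγ ?_ ?_
    · simp [hφ.2.1]
    · rw [← hv, hφ.2.1]
  refine Prod.ext (congrFun h t) ?_
  rw [hv, h]

theorem IsELFlow.apply_apply (hk : 2 ≤ k) (hL : IsTonelliLagrangian n (k : ℕ∞) L)
    (hφ : IsELFlow n k L φ) (s t : ℝ) (z : E n × E n) : φ t (φ s z) = φ (t + s) z := by
  have hd : ∀ u, deriv (fun t => (φ (t + s) z).1) u = (φ (u + s) z).2 := fun u =>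
    (HasDerivAt.comp_add_const u s (hφ.hasDerivAt_fst z (u + s))).deriv
  have := hφ.apply_eq_of_isExtremal hk hL ((hφ.2.2 z.1 z.2).1.comp_add_const s) t
  simp only [Prod.mk.eta] at this
  simpa only [hd, zero_add, Prod.mk.eta] using this

theorem IsELFlow.apply_add_intVec (hk : 2 ≤ k) (hL : IsTonelliLagrangian n (k : ℕ∞) L)
    (hφ : IsELFlow n k L φ) (t : ℝ) (x v : E n) (m : Fin n → ℤ) :
    φ t (x + intVec m, v) = ((φ t (x, v)).1 + intVec m, (φ t (x, v)).2) := by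
  obtain ⟨he, hv⟩ := hφ.2.2 x v
  have := hφ.apply_eq_of_isExtremal hk hL (he.add_intVec hL m) t
  simpa only [deriv_add_const, ← hv, hφ.2.1] using this

end Flow

section ParametricIntegral

variable {H F : Type*} [NormedAddCommGroup H] [NormedSpace ℝ H]
  [NormedAddCommGroup F] [NormedSpace ℝ F]

/-- Differentiation under the integral sign, for integrands with jointly continuous derivative. -/
theorem hasFDerivAt_intervalIntegral_of_continuous [FiniteDimensional ℝ H]
    {f : H → ℝ → F} {f' : H → ℝ → H →L[ℝ] F}
    (hf : ∀ z s, HasFDerivAt (fun z => f z s) (f' z s) z) (hfc : ∀ z, Continuous (f z))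
    (hf' : Continuous (Function.uncurry f')) (a b : ℝ) (z : H) :
    HasFDerivAt (fun z => ∫ s in a..b, f z s) (∫ s in a..b, f' z s) z := by
  have : ProperSpace H := FiniteDimensional.proper_real H
  obtain ⟨C, hC⟩ := ((isCompact_closedBall z 1).prod
    (isCompact_uIcc (a := a) (b := b))).exists_bound_of_continuousOn hf'.continuousOn
  refine intervalIntegral.hasFDerivAt_integral_of_dominated_of_fderiv_le (F := f) (F' := f')
    (bound := fun _ => C) (Metric.ball_mem_nhds z one_pos)
    (Eventually.of_forall fun z => (hfc z).aestronglyMeasurable)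
    ((hfc z).intervalIntegrable _ _)
    (hf'.comp (Continuous.prodMk_right z)).aestronglyMeasurable
    (Eventually.of_forall fun s hs x hx =>
      hC (x, s) ⟨Metric.ball_subset_closedBall hx, uIoc_subset_uIcc hs⟩)
    intervalIntegrable_const (Eventually.of_forall fun s _ x _ => hf x s)

variable {g : ℝ × H → F}

theorem contDiff_integral_rescaled [FiniteDimensional ℝ H] (hg : ContDiff ℝ 1 g) :
    ContDiff ℝ 1 (fun p : ℝ × H => ∫ s in (0 : ℝ)..1, g (s * p.1, p.2)) := by
  have hf : ∀ (p : ℝ × H) (s : ℝ), HasFDerivAt (fun p : ℝ × H => g (s * p.1, p.2))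
      ((fderiv ℝ g (s * p.1, p.2)).comp (s • (ContinuousLinearMap.inl ℝ ℝ H).comp (.fst ℝ ℝ H) +
        (ContinuousLinearMap.inr ℝ ℝ H).comp (.snd ℝ ℝ H))) p := fun p s =>
    (hg.differentiable (by norm_num) _).hasFDerivAt.comp p
      (((hasFDerivAt_fst.const_mul s).prodMk hasFDerivAt_snd).congr_fderiv (by ext <;> simp))
  have hc : Continuous (Function.uncurry fun (p : ℝ × H) (s : ℝ) =>
      (fderiv ℝ g (s * p.1, p.2)).comp (s • (ContinuousLinearMap.inl ℝ ℝ H).comp (.fst ℝ ℝ H) +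
        (ContinuousLinearMap.inr ℝ ℝ H).comp (.snd ℝ ℝ H))) := by
    have h1 := hg.continuous_fderiv (by norm_num)
    unfold Function.uncurry
    exact (h1.comp (by fun_prop)).clm_comp (by fun_prop)
  refine contDiff_one_iff_hasFDerivAt.2 ⟨_, ?_, fun p =>
    hasFDerivAt_intervalIntegral_of_continuous hf
      (fun p => hg.continuous.comp (by fun_prop)) hc 0 1 p⟩
  exact intervalIntegral.continuous_parametric_intervalIntegral_of_continuous' hc 0 1

theorem integral_eq_smul_integral_rescaled {H F : Type*} [NormedAddCommGroup F] [NormedSpace ℝ F]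
    {g : ℝ × H → F} (p : ℝ × H) :
    ∫ s in (0 : ℝ)..p.1, g (s, p.2) = p.1 • ∫ s in (0 : ℝ)..1, g (s * p.1, p.2) := by
  rw [intervalIntegral.smul_integral_comp_mul_right (fun s => g (s, p.2))]
  simp

theorem contDiff_primitive [FiniteDimensional ℝ H] (hg : ContDiff ℝ 1 g) :
    ContDiff ℝ 1 (fun p : ℝ × H => ∫ s in (0 : ℝ)..p.1, g (s, p.2)) := by
  simp only [integral_eq_smul_integral_rescaled]
  exact contDiff_fst.smul (contDiff_integral_rescaled hg)

theorem hasFDerivAt_right_of_contDiff (hg : ContDiff ℝ 1 g) (s : ℝ) (z : H) :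
    HasFDerivAt (fun z => g (s, z))
      ((fderiv ℝ g (s, z)).comp (ContinuousLinearMap.inr ℝ ℝ H)) z :=
  (hg.differentiable (by norm_num) _).hasFDerivAt.comp z (hasFDerivAt_prodMk_right s z)

theorem continuous_fderiv_right (hg : ContDiff ℝ 1 g) :
    Continuous fun p : ℝ × H => fderiv ℝ (fun z => g (p.1, z)) p.2 := by
  simp only [(hasFDerivAt_right_of_contDiff hg _ _).fderiv]
  exact (hg.continuous_fderiv (by norm_num)).clm_comp continuous_const

theorem hasFDerivAt_primitive_right [FiniteDimensional ℝ H] (hg : ContDiff ℝ 1 g) (t : ℝ) (z : H) :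
    HasFDerivAt (fun z => ∫ s in (0 : ℝ)..t, g (s, z))
      (∫ s in (0 : ℝ)..t, fderiv ℝ (fun z => g (s, z)) z) z :=
  hasFDerivAt_intervalIntegral_of_continuous (f := fun z s => g (s, z))
    (f' := fun z s => fderiv ℝ (fun z => g (s, z)) z)
    (fun z s => (hasFDerivAt_right_of_contDiff hg s z).differentiableAt.hasFDerivAt)
    (fun z => hg.continuous.comp (by fun_prop))
    ((continuous_fderiv_right hg).comp (continuous_snd.prodMk continuous_fst)) 0 t z

end ParametricIntegral

section FirstVariation

variable {n : ℕ} {k : ℕ} {L : E n × E n → ℝ} {φ : ℝ → E n × E n → E n × E n}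

/-- The action of the orbit of `z` over the time interval `[0, t]`. -/
def orbitAction (L : E n × E n → ℝ) (φ : ℝ → E n × E n → E n × E n) (t : ℝ) (z : E n × E n) : ℝ :=
  ∫ s in (0 : ℝ)..t, L (φ s z)

/-- The mean velocity over `[0, t]` of the extremal with initial condition `z`, extended
continuously to `t = 0`. -/
def meanVelocity (φ : ℝ → E n × E n → E n × E n) (t : ℝ) (z : E n × E n) : E n :=
  ∫ s in (0 : ℝ)..1, (φ (s * t) z).2

theorem IsELFlow.differentiable (hk : 2 ≤ k) (hφ : IsELFlow n k L φ) (t : ℝ) :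
    Differentiable ℝ (φ t) := fun z =>
  (hasFDerivAt_right_of_contDiff (hφ.contDiff_one hk) t z).differentiableAt

theorem IsELFlow.continuous_fderiv (hk : 2 ≤ k) (hφ : IsELFlow n k L φ) :
    Continuous fun p : ℝ × (E n × E n) => fderiv ℝ (φ p.1) p.2 :=
  continuous_fderiv_right (hφ.contDiff_one hk)

theorem IsELFlow.continuous_orbit (hk : 2 ≤ k) (hφ : IsELFlow n k L φ) (z : E n × E n) :
    Continuous fun t => φ t z :=
  (hφ.contDiff_one hk).continuous.comp (Continuous.prodMk_left z)

theorem IsELFlow.fst_eq_integral (hk : 2 ≤ k) (hφ : IsELFlow n k L φ) (t : ℝ) (z : E n × E n) :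
    (φ t z).1 = z.1 + ∫ s in (0 : ℝ)..t, (φ s z).2 := by
  rw [intervalIntegral.integral_eq_sub_of_hasDerivAt (fun s _ => hφ.hasDerivAt_fst z s)
    ((hφ.continuous_orbit hk z).snd.intervalIntegrable _ _), hφ.2.1]
  simp

theorem IsELFlow.fst_eq_add_smul_meanVelocity (hk : 2 ≤ k) (hφ : IsELFlow n k L φ) (t : ℝ)
    (z : E n × E n) : (φ t z).1 = z.1 + t • meanVelocity φ t z := by
  rw [hφ.fst_eq_integral hk, meanVelocity,
    integral_eq_smul_integral_rescaled (g := fun p : ℝ × (E n × E n) => (φ p.1 p.2).2) (t, z)]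

theorem IsELFlow.contDiff_meanVelocity (hk : 2 ≤ k) (hφ : IsELFlow n k L φ) :
    ContDiff ℝ 1 fun p : ℝ × (E n × E n) => meanVelocity φ p.1 p.2 :=
  contDiff_integral_rescaled (hφ.contDiff_one hk).snd

/-- The position component of a Jacobi field has derivative its velocity component. -/
theorem IsELFlow.hasDerivAt_fderiv_fst (hk : 2 ≤ k) (hφ : IsELFlow n k L φ) (z ζ : E n × E n)
    (t : ℝ) : HasDerivAt (fun s => (fderiv ℝ (φ s) z ζ).1) (fderiv ℝ (φ t) z ζ).2 t := by
  have hc : Continuous fun s => (fderiv ℝ (φ s) z ζ).2 :=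
    (((hφ.continuous_fderiv hk).comp (Continuous.prodMk_left z)).clm_apply continuous_const).snd
  have h : ∀ s, (fderiv ℝ (φ s) z ζ).1 = ζ.1 + ∫ σ in (0 : ℝ)..s, (fderiv ℝ (φ σ) z ζ).2 := by
    intro s
    have h1 := (hφ.differentiable hk s z).hasFDerivAt.fst
    have h2 := (hasFDerivAt_fst (𝕜 := ℝ) (p := z)).add
      (hasFDerivAt_primitive_right (hφ.contDiff_one hk).snd s z)
    have h3 : ∀ σ : ℝ, fderiv ℝ (fun z => (φ σ z).2) z =
        (ContinuousLinearMap.snd ℝ _ _).comp (fderiv ℝ (φ σ) z) := fun σ =>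
      (hφ.differentiable hk σ z).hasFDerivAt.snd.fderiv
    have h4 := h1.unique (h2.congr_of_eventuallyEq
      (Eventually.of_forall fun z => hφ.fst_eq_integral hk s z))
    have h5 := congrArg (fun A => A ζ) h4
    simp only [h3] at h5
    rw [add_apply, ContinuousLinearMap.intervalIntegral_apply] at h5
    · simpa using h5
    · exact (continuous_const.clm_comp
        ((hφ.continuous_fderiv hk).comp (Continuous.prodMk_left z))).intervalIntegrable _ _
  rw [funext h]
  exact (intervalIntegral.integral_hasDerivAt_right (hc.intervalIntegrable _ _)
    (hc.stronglyMeasurableAtFilter _ _) hc.continuousAt).const_add _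

theorem contDiff_orbitAction (hk : 2 ≤ k) (hL : IsTonelliLagrangian n (k : ℕ∞) L)
    (hφ : IsELFlow n k L φ) :
    ContDiff ℝ 1 fun p : ℝ × (E n × E n) => orbitAction L φ p.1 p.2 :=
  contDiff_primitive (((hL.contDiff_two hk).of_le (by norm_num)).comp (hφ.contDiff_one hk))

theorem hasDerivAt_orbitAction (hk : 2 ≤ k) (hL : IsTonelliLagrangian n (k : ℕ∞) L)
    (hφ : IsELFlow n k L φ) (z : E n × E n) (t : ℝ) :
    HasDerivAt (fun t => orbitAction L φ t z) (L (φ t z)) t := by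
  have hc := (hL.contDiff_two hk).continuous.comp (hφ.continuous_orbit hk z)
  exact intervalIntegral.integral_hasDerivAt_right (hc.intervalIntegrable _ _)
    (hc.stronglyMeasurableAtFilter _ _) hc.continuousAt

/-- First variation formula for the action of orbits. -/
theorem fderiv_orbitAction (hk : 2 ≤ k) (hL : IsTonelliLagrangian n (k : ℕ∞) L)
    (hφ : IsELFlow n k L φ) (t : ℝ) (z ζ : E n × E n) :
    fderiv ℝ (orbitAction L φ t) z ζ =
      partialV n L (φ t z).1 (φ t z).2 (fderiv ℝ (φ t) z ζ).1 - partialV n L z.1 z.2 ζ.1 := by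
  have hL2 := hL.contDiff_two hk
  have hg : ContDiff ℝ 1 fun p : ℝ × (E n × E n) => L (φ p.1 p.2) :=
    (hL2.of_le (by norm_num)).comp (hφ.contDiff_one hk)
  have hcF : Continuous fun s => fderiv ℝ (fun z => L (φ s z)) z :=
    (continuous_fderiv_right hg).comp (Continuous.prodMk_left z)
  have hd : ∀ s : ℝ, HasDerivAt
      (fun s => partialV n L (φ s z).1 (φ s z).2 (fderiv ℝ (φ s) z ζ).1)
      (fderiv ℝ (fun z => L (φ s z)) z ζ) s := by
    intro s
    obtain ⟨he, hv⟩ := hφ.2.2 z.1 z.2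
    have h1 := he.2 s
    simp only [← hv] at h1
    refine (h1.clm_apply (hφ.hasDerivAt_fderiv_fst hk z ζ s)).congr_deriv ?_
    have h2 := ((hL2.differentiable (by norm_num) (φ s z)).hasFDerivAt.comp z
      (hφ.differentiable hk s z).hasFDerivAt).fderiv
    rw [show (fun z => L (φ s z)) = L ∘ φ s from rfl, h2, ContinuousLinearMap.comp_apply,
      fderiv_lagrangian_apply hL2]
  rw [show orbitAction L φ t = fun z => ∫ s in (0 : ℝ)..t, L (φ s z) from rfl,
    (hasFDerivAt_primitive_right hg t z).fderiv,
    ContinuousLinearMap.intervalIntegral_apply (hcF.intervalIntegrable _ _),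
    intervalIntegral.integral_eq_sub_of_hasDerivAt (fun s _ => hd s)
      ((hcF.clm_apply continuous_const).intervalIntegrable _ _)]
  have h0 : φ 0 = id := funext hφ.2.1
  simp [h0]

theorem exists_hasFDerivAt_orbitAction (hk : 2 ≤ k) (hL : IsTonelliLagrangian n (k : ℕ∞) L)
    (hφ : IsELFlow n k L φ) (t : ℝ) (z : E n × E n) :
    ∃ A : ℝ × (E n × E n) →L[ℝ] ℝ,
      HasFDerivAt (fun p : ℝ × (E n × E n) => orbitAction L φ p.1 p.2) A (t, z) ∧
      ∀ τ ζ, A (τ, ζ) = τ * L (φ t z) +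
        (partialV n L (φ t z).1 (φ t z).2 (fderiv ℝ (φ t) z ζ).1 - partialV n L z.1 z.2 ζ.1) := by
  have hC := contDiff_orbitAction hk hL hφ
  have h := (hC.differentiable (by norm_num) (t, z)).hasFDerivAt
  refine ⟨_, h, fun τ ζ => ?_⟩
  have h0 : HasDerivAt (fun t => orbitAction L φ t z) (fderiv ℝ
      (fun p : ℝ × (E n × E n) => orbitAction L φ p.1 p.2) (t, z) (1, 0)) t :=
    HasFDerivAt.comp_hasDerivAt (f := fun t => (t, z)) t h
      ((hasDerivAt_id t).prodMk (hasDerivAt_const t z))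
  have h1 := h0.unique (hasDerivAt_orbitAction hk hL hφ z t)
  have h2 := (hasFDerivAt_right_of_contDiff hC t z).fderiv
  rw [← fderiv_orbitAction hk hL hφ, show orbitAction L φ t =
    fun z => orbitAction L φ (t, z).1 (t, z).2 from rfl, h2, ← h1,
    show (τ, ζ) = τ • ((1 : ℝ), (0 : E n × E n)) + (0, ζ) by simp, map_add, map_smul]
  rfl

end FirstVariation

/-- Inverse function theorem for an endomorphism with injective differential. -/
theorem exists_openPartialHomeomorph_of_fderiv_injective {P : Type*} [NormedAddCommGroup P]
    [NormedSpace ℝ P] [FiniteDimensional ℝ P] {f : P → P} {a : P} {m : WithTop ℕ∞}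
    (hf : ContDiffAt ℝ m f a) (hm : m ≠ 0) (hinj : ∀ w, fderiv ℝ f a w = 0 → w = 0) :
    ∃ e : OpenPartialHomeomorph P P, a ∈ e.source ∧ (e : P → P) = f ∧
      ContDiffAt ℝ m e.symm (f a) := by
  have : CompleteSpace P := FiniteDimensional.complete ℝ P
  let A : P ≃L[ℝ] P := (LinearEquiv.ofInjectiveEndo (fderiv ℝ f a).toLinearMap
    ((injective_iff_map_eq_zero _).2 hinj)).toContinuousLinearEquiv
  have hA : HasFDerivAt f (A : P →L[ℝ] P) a :=
    (hf.differentiableAt hm).hasFDerivAt.congr_fderiv (by ext; rfl)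
  exact ⟨hf.toOpenPartialHomeomorph f hA hm, hf.mem_toOpenPartialHomeomorph_source hA hm, rfl,
    hf.to_localInverse hA hm⟩

section Weierstrass

variable {n : ℕ} {k : ℕ} {L : E n × E n → ℝ} {φ : ℝ → E n × E n → E n × E n}

theorem IsELFlow.exists_hasFDerivAt_fst (hk : 2 ≤ k) (hφ : IsELFlow n k L φ) (t : ℝ)
    (z : E n × E n) : ∃ A : ℝ × (E n × E n) →L[ℝ] E n,
      HasFDerivAt (fun p : ℝ × (E n × E n) => (φ p.1 p.2).1) A (t, z) ∧
      ∀ τ ζ, A (τ, ζ) = τ • (φ t z).2 + (fderiv ℝ (φ t) z ζ).1 := by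
  have h := ((hφ.contDiff_one hk).fst.differentiable (by norm_num) (t, z)).hasFDerivAt
  refine ⟨_, h, fun τ ζ => ?_⟩
  have h0 := HasFDerivAt.comp_hasDerivAt (f := fun t => (t, z)) t h
      ((hasDerivAt_id t).prodMk (hasDerivAt_const t z))
  have h1 := h0.unique (hφ.hasDerivAt_fst z t)
  have h2 := (hasFDerivAt_right_of_contDiff (hφ.contDiff_one hk).fst t z).fderiv
  have h3 := (hφ.differentiable hk t z).hasFDerivAt.fst.fderiv
  have h4 := congrArg (fun B => B ζ) (h3.symm.trans h2)
  simp only [ContinuousLinearMap.comp_apply, ContinuousLinearMap.inr_apply,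
    ContinuousLinearMap.coe_fst'] at h4
  rw [h4, ← h1, show (τ, ζ) = τ • ((1 : ℝ), (0 : E n × E n)) + (0, ζ) by simp, map_add, map_smul]

/-- Weierstrass comparison: a curve `c` which lifts to the field of extremals issued from `x`
has action at least the increment of the action of these extremals. -/
theorem orbitAction_sub_le (hk : 2 ≤ k) (hL : IsTonelliLagrangian n (k : ℕ∞) L)
    (hφ : IsELFlow n k L φ) {a b : ℝ} (hab : a ≤ b) {x : E n} {v c c' : ℝ → E n}
    (hv : ContinuousOn v (Icc a b)) (hvd : ∀ t ∈ Ioo a b, DifferentiableAt ℝ v t)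
    (hc : ∀ t, HasDerivAt c (c' t) t) (hc' : Continuous c')
    (hvc : ∀ t ∈ Ioo a b, (φ t (x, v t)).1 = c t) :
    orbitAction L φ b (x, v b) - orbitAction L φ a (x, v a) ≤ ∫ t in a..b, L (c t, c' t) := by
  have hL2 := hL.contDiff_two hk
  have hcc : Continuous fun t => L (c t, c' t) := hL2.continuous.comp
    ((continuous_iff_continuousAt.2 fun t => (hc t).continuousAt).prodMk hc')
  have hI : ∀ t, HasDerivAt (fun t => ∫ s in a..t, L (c s, c' s)) (L (c t, c' t)) t := fun t =>
    intervalIntegral.integral_hasDerivAt_right (hcc.intervalIntegrable _ _)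
    (hcc.stronglyMeasurableAtFilter _ _) hcc.continuousAt
  let f : ℝ → ℝ := fun t => orbitAction L φ t (x, v t) - ∫ s in a..t, L (c s, c' s)
  have hd : ∀ t ∈ Ioo a b, ∃ f', HasDerivAt f f' t ∧ f' ≤ 0 := by
    intro t ht
    have hvt := (hvd t ht).hasDerivAt
    set v' := deriv v t
    have hcurve : HasDerivAt (fun t => (t, (x, v t))) ((1 : ℝ), ((0 : E n), v')) t :=
      (hasDerivAt_id t).prodMk ((hasDerivAt_const t x).prodMk hvt)
    obtain ⟨A, hA, hAeq⟩ := exists_hasFDerivAt_orbitAction hk hL hφ t (x, v t)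
    obtain ⟨B, hB, hBeq⟩ := hφ.exists_hasFDerivAt_fst hk t (x, v t)
    have h1 := HasFDerivAt.comp_hasDerivAt (f := fun t => (t, (x, v t))) t hA hcurve
    have h2 := HasFDerivAt.comp_hasDerivAt (f := fun t => (t, (x, v t))) t hB hcurve
    refine ⟨_, h1.sub (hI t), ?_⟩
    have h3 := (h2.congr_of_eventuallyEq (f₁ := c) (by
      filter_upwards [Ioo_mem_nhds ht.1 ht.2] with s hs using (hvc s hs).symm)).unique (hc t)
    have h4 := partialV_apply_sub_le hL2 hL.posdef (c t) (φ t (x, v t)).2 (c' t)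
    rw [← h3, hBeq] at h4
    rw [hAeq, ← h3, hBeq]
    have hz : φ t (x, v t) = (c t, (φ t (x, v t)).2) := Prod.ext (hvc t ht) rfl
    rw [hz] at h4 ⊢
    simp only [one_smul, add_sub_cancel_left, map_zero, sub_zero, one_mul] at h4 ⊢
    linarith
  have hanti : AntitoneOn f (Icc a b) := by
    refine antitoneOn_of_deriv_nonpos (convex_Icc a b) ?_ ?_ ?_
    · refine ContinuousOn.sub ?_
        (continuous_iff_continuousAt.2 fun t => (hI t).continuousAt).continuousOn
      exact (contDiff_orbitAction hk hL hφ).continuous.comp_continuousOn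
        (continuousOn_id.prodMk (continuousOn_const.prodMk hv))
    · intro t ht
      rw [interior_Icc] at ht
      obtain ⟨f', h, -⟩ := hd t ht
      exact h.differentiableAt.differentiableWithinAt
    · intro t ht
      rw [interior_Icc] at ht
      obtain ⟨f', h, h0⟩ := hd t ht
      rwa [h.deriv]
  have := hanti ⟨le_rfl, hab⟩ ⟨hab, le_rfl⟩ hab
  simp only [f, intervalIntegral.integral_same] at this
  linarith

end Weierstrass

section Coercivity

variable {n : ℕ} {k : ℕ} {L : E n × E n → ℝ} {φ : ℝ → E n × E n → E n × E n}

theorem exists_eq_add_intVec (y : E n) :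
    ∃ m : Fin n → ℤ, ∃ y' ∈ Icc (0 : E n) 1, y = y' + intVec m :=
  ⟨fun i => ⌊y i⌋, fun i => Int.fract (y i),
    ⟨fun i => Int.fract_nonneg (y i), fun i => (Int.fract_lt_one (y i)).le⟩,
    funext fun i => (Int.fract_add_floor (y i)).symm⟩

/-- Extremals which are slow at some time in `[0, T]` have bounded initial velocity. -/
theorem IsELFlow.exists_norm_le_of_norm_snd_le (hk : 2 ≤ k)
    (hL : IsTonelliLagrangian n (k : ℕ∞) L) (hφ : IsELFlow n k L φ) (T M : ℝ) :
    ∃ R, ∀ s ∈ Icc 0 T, ∀ x v : E n, ‖(φ s (x, v)).2‖ ≤ M → ‖v‖ ≤ R := by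
  obtain ⟨R, hR⟩ := ((isCompact_Icc (a := -T) (b := 0)).prod
    ((isCompact_Icc (a := (0 : E n)) (b := 1)).prod
      (isCompact_closedBall (0 : E n) M))).exists_bound_of_continuousOn
        (hφ.contDiff_one hk).continuous.snd.continuousOn
  refine ⟨R, fun s hs x v hv => ?_⟩
  obtain ⟨m, y, hy, hm⟩ := exists_eq_add_intVec (φ s (x, v)).1
  have h1 := hR (-s, (y, (φ s (x, v)).2))
    ⟨⟨by linarith [hs.2], by linarith [hs.1]⟩, hy, by simpa using hv⟩
  have h2 := hφ.apply_add_intVec hk hL (-s) y (φ s (x, v)).2 m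
  rw [← hm, Prod.mk.eta, hφ.apply_apply hk hL, neg_add_cancel, hφ.2.1] at h2
  rwa [← congrArg Prod.snd h2] at h1

/-- Sublevels of the action, at times bounded away from `0`, are bounded. -/
theorem exists_norm_le_of_orbitAction_le (hk : 2 ≤ k)
    (hL : IsTonelliLagrangian n (k : ℕ∞) L) (hφ : IsELFlow n k L φ) {t₀ : ℝ} (ht₀ : 0 < t₀)
    (T B : ℝ) :
    ∃ R, ∀ t ∈ Icc t₀ T, ∀ x v : E n, orbitAction L φ t (x, v) ≤ B → ‖v‖ ≤ R := by
  obtain ⟨R₁, hR₁⟩ := hL.superlinear 1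
  set M := max R₁ ((|B| + 1) / t₀)
  obtain ⟨R, hR⟩ := hφ.exists_norm_le_of_norm_snd_le hk hL T M
  refine ⟨R, fun t ht x v hB => ?_⟩
  by_contra hv
  have ht0 : 0 ≤ t := ht₀.le.trans ht.1
  have hlow : ∀ s ∈ Icc 0 t, M ≤ L (φ s (x, v)) := by
    intro s hs
    have h1 : M ≤ ‖(φ s (x, v)).2‖ := le_of_not_ge fun h =>
      hv (hR s ⟨hs.1, hs.2.trans ht.2⟩ x v h)
    have h2 := hR₁ (φ s (x, v)).1 (φ s (x, v)).2 ((le_max_left _ _).trans h1)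
    rw [one_mul] at h2
    exact h1.trans h2
  have hint := intervalIntegral.integral_mono_on (μ := volume) ht0
    (f := fun _ => M) (g := fun s => L (φ s (x, v))) intervalIntegrable_const
    (((hL.contDiff_two hk).continuous.comp (hφ.continuous_orbit hk _)).intervalIntegrable _ _) hlow
  rw [intervalIntegral.integral_const, sub_zero, smul_eq_mul] at hint
  have hM : |B| + 1 ≤ t * M := by
    have h1 : (|B| + 1) / t₀ ≤ M := le_max_right _ _
    rw [div_le_iff₀ ht₀] at h1
    have h2 : 0 ≤ M := le_trans (by positivity) (le_max_right _ _)
    nlinarith [ht.1]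
  have hB' : ∫ s in (0 : ℝ)..t, L (φ s (x, v)) ≤ B := hB
  linarith [le_abs_self B]

end Coercivity

section ExponentialMap

variable {n : ℕ} {k : ℕ} {L : E n × E n → ℝ} {φ : ℝ → E n × E n → E n × E n}

/-- Time and mean velocity as functions of time and initial velocity, for a fixed origin `x`. -/
def velocityMap (φ : ℝ → E n × E n → E n × E n) (x : E n) (p : ℝ × E n) : ℝ × E n :=
  (p.1, meanVelocity φ p.1 (x, p.2))

theorem IsELFlow.contDiff_velocityMap (hk : 2 ≤ k) (hφ : IsELFlow n k L φ) (x : E n) :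
    ContDiff ℝ 1 (velocityMap φ x) :=
  contDiff_fst.prodMk ((hφ.contDiff_meanVelocity hk).comp
    (contDiff_fst.prodMk (contDiff_const.prodMk contDiff_snd)))

theorem IsELFlow.meanVelocity_zero (hφ : IsELFlow n k L φ) (z : E n × E n) :
    meanVelocity φ 0 z = z.2 := by
  simp [meanVelocity, hφ.2.1]

theorem IsELFlow.hasFDerivAt_fst_vertical (hk : 2 ≤ k) (hφ : IsELFlow n k L φ) (t : ℝ) (x v : E n) :
    HasFDerivAt (fun v => (φ t (x, v)).1)
      ((ContinuousLinearMap.fst ℝ (E n) (E n)).comp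
        ((fderiv ℝ (φ t) (x, v)).comp (ContinuousLinearMap.inr ℝ (E n) (E n)))) v :=
  ((hφ.differentiable hk t (x, v)).hasFDerivAt.comp v (hasFDerivAt_prodMk_right x v)).fst

theorem IsELFlow.fderiv_velocityMap_injective (hk : 2 ≤ k) (hφ : IsELFlow n k L φ)
    (hnc : NoConjugatePoints n φ) (x : E n) (p w : ℝ × E n)
    (h : fderiv ℝ (velocityMap φ x) p w = 0) : w = 0 := by
  obtain ⟨t, v⟩ := p
  obtain ⟨τ, η⟩ := w
  have hF := ((hφ.contDiff_velocityMap hk x).differentiable (by norm_num) (t, v)).hasFDerivAt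
  have hτ : τ = 0 := by
    have h1 := hF.fst.unique (hasFDerivAt_fst (𝕜 := ℝ) (p := (t, v)))
    have h2 := congrArg (fun A => A (τ, η)) h1
    simpa [h] using h2.symm
  subst hτ
  have hM := (hF.comp v (hasFDerivAt_prodMk_right t v)).snd
  have hM0 : (ContinuousLinearMap.snd ℝ ℝ (E n)).comp ((fderiv ℝ (velocityMap φ x) (t, v)).comp
      (ContinuousLinearMap.inr ℝ ℝ (E n))) η = 0 := by
    simp [h]
  suffices η = 0 by simp [this]
  rcases eq_or_ne t 0 with rfl | ht
  · have h1 : HasFDerivAt (fun v : E n => v) _ v := hM.congr_of_eventuallyEq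
      (Eventually.of_forall fun v => (hφ.meanVelocity_zero (x, v)).symm)
    have h2 := congrArg (fun A => A η) (h1.unique (hasFDerivAt_id v))
    exact h2.symm.trans hM0
  · have h1 := ((hM.const_smul t).const_add x).unique
      ((hφ.hasFDerivAt_fst_vertical hk t x v).congr_of_eventuallyEq
        (Eventually.of_forall fun v => (hφ.fst_eq_add_smul_meanVelocity hk t (x, v)).symm))
    refine hnc (x, v) t ht η ?_
    have h2 := congrArg (fun A => A η) h1
    rw [smul_apply, hM0, smul_zero] at h2
    simpa using h2.symm

theorem IsELFlow.exists_localInverse_velocityMap (hk : 2 ≤ k) (hφ : IsELFlow n k L φ)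
    (hnc : NoConjugatePoints n φ) (x : E n) (p : ℝ × E n) :
    ∃ e : OpenPartialHomeomorph (ℝ × E n) (ℝ × E n), p ∈ e.source ∧
      (e : ℝ × E n → ℝ × E n) = velocityMap φ x ∧ ContDiffAt ℝ 1 e.symm (velocityMap φ x p) :=
  exists_openPartialHomeomorph_of_fderiv_injective (hφ.contDiff_velocityMap hk x).contDiffAt
    one_ne_zero (hφ.fderiv_velocityMap_injective hk hnc x p)

theorem IsELFlow.isLocalHomeomorph_velocityMap (hk : 2 ≤ k) (hφ : IsELFlow n k L φ)
    (hnc : NoConjugatePoints n φ) (x : E n) : IsLocalHomeomorph (velocityMap φ x) := fun p => by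
  obtain ⟨e, he, heq, -⟩ := hφ.exists_localInverse_velocityMap hk hnc x p
  exact ⟨e, he, heq.symm⟩

/-- `v` lifts to initial velocities the straight line `t ↦ x + t • w` on `[0, τ]`. -/
def IsLineLift (φ : ℝ → E n × E n → E n × E n) (x w : E n) (τ : ℝ) (v : ℝ → E n) : Prop :=
  ContinuousOn v (Icc 0 τ) ∧ v 0 = w ∧ ∀ t ∈ Icc 0 τ, meanVelocity φ t (x, v t) = w

theorem IsLineLift.differentiableAt (hk : 2 ≤ k) (hφ : IsELFlow n k L φ)
    (hnc : NoConjugatePoints n φ) {x w : E n} {τ : ℝ} {v : ℝ → E n}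
    (hv : IsLineLift φ x w τ v) {t : ℝ} (ht : t ∈ Ioo 0 τ) : DifferentiableAt ℝ v t := by
  obtain ⟨e, he, heq, hed⟩ := hφ.exists_localInverse_velocityMap hk hnc x (t, v t)
  have hF : ∀ s ∈ Icc 0 τ, velocityMap φ x (s, v s) = (s, w) := fun s hs =>
    Prod.ext rfl (hv.2.2 s hs)
  rw [hF t (Ioo_subset_Icc_self ht)] at hed
  have hvt : ContinuousAt v t := hv.1.continuousAt (Icc_mem_nhds ht.1 ht.2)
  have hev : ∀ᶠ s in 𝓝 t, v s = (e.symm (s, w)).2 := by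
    filter_upwards [(continuousAt_id.prodMk hvt).preimage_mem_nhds (e.open_source.mem_nhds he),
      Icc_mem_nhds ht.1 ht.2] with s hs hs'
    have : e.symm (e (s, v s)) = (s, v s) := e.left_inv hs
    rw [heq, hF s hs'] at this
    rw [this]
  refine DifferentiableAt.congr_of_eventuallyEq ?_ hev
  exact ((hed.differentiableAt one_ne_zero).comp t
    (differentiableAt_id.prodMk (differentiableAt_const w))).snd

theorem IsLineLift.orbitAction_le (hk : 2 ≤ k) (hL : IsTonelliLagrangian n (k : ℕ∞) L)
    (hφ : IsELFlow n k L φ) (hnc : NoConjugatePoints n φ) (x w : E n) (T : ℝ) :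
    ∃ B, ∀ τ ∈ Icc 0 T, ∀ v, IsLineLift φ x w τ v → orbitAction L φ τ (x, v τ) ≤ B := by
  have hc : ∀ t, HasDerivAt (fun t : ℝ => x + t • w) w t := fun t => by
    simpa using ((hasDerivAt_id t).smul_const w).const_add x
  have hcc : Continuous fun t : ℝ => L (x + t • w, w) :=
    (hL.contDiff_two hk).continuous.comp (by fun_prop)
  have hprim : Continuous fun τ => ∫ t in (0 : ℝ)..τ, L (x + t • w, w) :=
    intervalIntegral.continuous_primitive (fun _ _ => hcc.intervalIntegrable _ _) 0
  obtain ⟨B, hB⟩ := (isCompact_Icc (a := 0) (b := T)).exists_bound_of_continuousOn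
    hprim.continuousOn
  refine ⟨B, fun τ hτ v hv => ?_⟩
  have h := orbitAction_sub_le hk hL hφ hτ.1 hv.1
    (fun t ht => hv.differentiableAt hk hφ hnc ht) hc continuous_const fun t ht => by
      rw [hφ.fst_eq_add_smul_meanVelocity hk, hv.2.2 t (Ioo_subset_Icc_self ht)]
  have h0 : orbitAction L φ 0 (x, v 0) = 0 := by simp [orbitAction]
  rw [h0, sub_zero] at h
  exact h.trans ((Real.le_norm_self _).trans (hB τ hτ))

/-- A limit of lifts can be extended a little further. -/
theorem exists_isLineLift_extension (hk : 2 ≤ k) (hφ : IsELFlow n k L φ)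
    (hnc : NoConjugatePoints n φ) {x w u : E n} {t : ℝ}
    (hu : meanVelocity φ t (x, u) = w)
    (hlim : ∀ N ∈ 𝓝 (t, u), ∃ τ v, 0 ≤ τ ∧ τ ≤ t ∧ IsLineLift φ x w τ v ∧ (τ, v τ) ∈ N) :
    ∃ t' > t, ∃ v, IsLineLift φ x w t' v := by
  obtain ⟨e, he, heq, -⟩ := hφ.exists_localInverse_velocityMap hk hnc x (t, u)
  have htw : (t, w) ∈ e.target := by
    have := e.map_source he
    rwa [heq, velocityMap, hu] at this
  have hopen : IsOpen {s : ℝ | (s, w) ∈ e.target} :=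
    e.open_target.preimage (Continuous.prodMk_left w)
  obtain ⟨δ, hδ, hball⟩ := Metric.isOpen_iff.1 hopen t htw
  obtain ⟨τ, v, hτ0, hτt, hv, hτ⟩ := hlim
    (e.source ∩ Metric.ball t δ ×ˢ univ) (inter_mem (e.open_source.mem_nhds he)
      (prod_mem_nhds (Metric.ball_mem_nhds t hδ) univ_mem))
  have hsub : Icc τ (t + δ / 2) ⊆ {s : ℝ | (s, w) ∈ e.target} := by
    intro s hs
    refine hball ?_
    have h1 := hτ.2.1
    rw [Metric.mem_ball, Real.dist_eq, abs_lt] at h1 ⊢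
    constructor <;> linarith [hs.1, hs.2]
  let u' : ℝ → E n := fun s => (e.symm (s, w)).2
  have hu' : ContinuousOn u' (Icc τ (t + δ / 2)) :=
    (e.symm.continuousOn.comp (Continuous.prodMk_left w).continuousOn hsub).snd
  have hu'F : ∀ s ∈ Icc τ (t + δ / 2), meanVelocity φ s (x, u' s) = w := by
    intro s hs
    have h1 := e.right_inv (hsub hs)
    rw [heq, velocityMap] at h1
    have h2 := congrArg Prod.fst h1
    have h3 := congrArg Prod.snd h1
    simp only at h2 h3
    rwa [h2] at h3
  have hτv : u' τ = v τ := by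
    have h1 := e.left_inv hτ.1
    rw [heq, velocityMap, hv.2.2 τ ⟨hτ0, le_rfl⟩] at h1
    exact congrArg Prod.snd h1
  classical
  let V : ℝ → E n := fun s => if s ≤ τ then v s else u' s
  have hV1 : EqOn V v (Icc 0 τ) := fun s hs => if_pos hs.2
  have hV2 : EqOn V u' (Icc τ (t + δ / 2)) := by
    intro s hs
    rcases hs.1.eq_or_lt with rfl | h
    · simp [V, hτv]
    · exact if_neg h.not_ge
  have hunion : Icc 0 τ ∪ Icc τ (t + δ / 2) = Icc 0 (t + δ / 2) :=
    Icc_union_Icc_eq_Icc hτ0 (by linarith)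
  refine ⟨t + δ / 2, by linarith, V, ?_, ?_, ?_⟩
  · rw [← hunion]
    exact (hv.1.congr hV1).union_of_isClosed (hu'.congr hV2) isClosed_Icc isClosed_Icc
  · rw [hV1 ⟨le_rfl, hτ0⟩, hv.2.1]
  · intro s hs
    rw [← hunion] at hs
    rcases hs with hs | hs
    · rw [hV1 hs, hv.2.2 s hs]
    · rw [hV2 hs, hu'F s hs]

theorem exists_isLineLift (hk : 2 ≤ k) (hL : IsTonelliLagrangian n (k : ℕ∞) L)
    (hφ : IsELFlow n k L φ) (hnc : NoConjugatePoints n φ) (x w : E n) {T : ℝ} (hT : 0 ≤ T) :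
    ∃ v, IsLineLift φ x w T v := by
  have hrestrict : ∀ {τ τ' : ℝ} {v : ℝ → E n}, τ' ≤ τ → IsLineLift φ x w τ v →
      IsLineLift φ x w τ' v := fun h hv =>
    ⟨hv.1.mono (Icc_subset_Icc_right h), hv.2.1, fun t ht => hv.2.2 t ⟨ht.1, ht.2.trans h⟩⟩
  let S : Set ℝ := {τ | τ ∈ Icc 0 T ∧ ∃ v, IsLineLift φ x w τ v}
  have h0S : (0 : ℝ) ∈ S := ⟨⟨le_rfl, hT⟩, fun _ => w, continuousOn_const, rfl, fun t ht => by
    rw [le_antisymm ht.2 ht.1, hφ.meanVelocity_zero]⟩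
  have hbdd : BddAbove S := ⟨T, fun τ hτ => hτ.1.2⟩
  have h0 : 0 ≤ sSup S := le_csSup hbdd h0S
  have hST : sSup S ≤ T := csSup_le ⟨0, h0S⟩ fun τ hτ => hτ.1.2
  obtain ⟨u, hu, hlim⟩ : ∃ u, meanVelocity φ (sSup S) (x, u) = w ∧ ∀ N ∈ 𝓝 (sSup S, u),
      ∃ τ v, 0 ≤ τ ∧ τ ≤ sSup S ∧ IsLineLift φ x w τ v ∧ (τ, v τ) ∈ N := by
    rcases h0.eq_or_lt with h | h
    · obtain ⟨v, hv⟩ := h0S.2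
      refine ⟨w, by rw [← h, hφ.meanVelocity_zero], fun N hN =>
        ⟨0, v, le_rfl, h0, hv, ?_⟩⟩
      rw [hv.2.1, h]
      exact mem_of_mem_nhds hN
    · obtain ⟨τ, -, hτlim, hτS⟩ := exists_seq_tendsto_sSup ⟨0, h0S⟩ hbdd
      choose hτI v hv using hτS
      obtain ⟨B, hB⟩ := IsLineLift.orbitAction_le hk hL hφ hnc x w T
      obtain ⟨R, hR⟩ := exists_norm_le_of_orbitAction_le hk hL hφ (half_pos h) T B
      have hev : ∀ᶠ j in atTop, v j (τ j) ∈ Metric.closedBall (0 : E n) R := by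
        filter_upwards [hτlim.eventually (lt_mem_nhds (half_lt_self h))] with j hj
        rw [mem_closedBall_zero_iff]
        exact hR (τ j) ⟨hj.le, (hτI j).2⟩ x _ (hB (τ j) (hτI j) (v j) (hv j))
      obtain ⟨u, -, σ, hσ, hu⟩ :=
        (isCompact_closedBall (0 : E n) R).isSeqCompact.subseq_of_frequently_in hev.frequently
      have hpair := (hτlim.comp hσ.tendsto_atTop).prodMk_nhds hu
      refine ⟨u, ?_, fun N hN => ?_⟩
      · have h1 := ((hφ.contDiff_velocityMap hk x).continuous.tendsto _).comp hpair
        have h2 : Tendsto (fun j => (velocityMap φ x (τ (σ j), v (σ j) (τ (σ j)))).2) atTop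
          (𝓝 (meanVelocity φ (sSup S) (x, u))) := (continuous_snd.tendsto _).comp h1
        refine tendsto_nhds_unique h2 (tendsto_const_nhds.congr fun j => ?_)
        exact ((hv (σ j)).2.2 _ ⟨(hτI _).1, le_rfl⟩).symm
      · obtain ⟨j, hj⟩ := (hpair.eventually_mem hN).exists
        exact ⟨τ (σ j), v (σ j), (hτI _).1, le_csSup hbdd ⟨hτI _, _, hv _⟩, hv _, hj⟩
  obtain ⟨t', ht', V, hV⟩ := exists_isLineLift_extension hk hφ hnc hu hlim
  by_contra hcon
  have hlt : sSup S < T := by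
    refine hST.lt_of_ne fun h => hcon ⟨V, hrestrict ?_ hV⟩
    rw [← h]; exact ht'.le
  have : min t' T ∈ S := ⟨⟨le_min (h0.trans ht'.le) hT, min_le_right _ _⟩, V,
    hrestrict (min_le_left _ _) hV⟩
  exact (lt_min ht' hlt).not_ge (le_csSup hbdd this)

/-- Without conjugate points, `v ↦ π φ_T(x, v)` is a bijection of `ℝⁿ`. -/
theorem IsELFlow.bijective_fst (hk : 2 ≤ k) (hL : IsTonelliLagrangian n (k : ℕ∞) L)
    (hφ : IsELFlow n k L φ) (hnc : NoConjugatePoints n φ) (x : E n) {T : ℝ} (hT : 0 < T) :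
    Function.Bijective fun v => (φ T (x, v)).1 := by
  choose V hV using fun w => exists_isLineLift hk hL hφ hnc x w hT.le
  have hhomeo := hφ.isLocalHomeomorph_velocityMap hk hnc x
  have hsep : IsSeparatedMap (velocityMap φ x) := T2Space.isSeparatedMap _
  have hmem : ∀ s : unitInterval, (s : ℝ) * T ∈ Icc 0 T := fun s =>
    ⟨mul_nonneg s.2.1 hT.le, mul_le_of_le_one_left hT.le s.2.2⟩
  let g : unitInterval × E n → ℝ × E n := fun p => ((p.1 : ℝ) * T, V p.2 (p.1 * T))
  let f : C(unitInterval × E n, ℝ × E n) := ⟨fun p => ((p.1 : ℝ) * T, p.2),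
    ((continuous_subtype_val.comp continuous_fst).mul continuous_const).prodMk continuous_snd⟩
  have hg : Continuous g := by
    refine hhomeo.continuous_lift hsep f (funext fun p => Prod.ext rfl ((hV p.2).2.2 _ (hmem p.1)))
      ?_ fun w => ?_
    · simp only [g, Icc.coe_zero, zero_mul, (hV _).2.1]
      exact Continuous.prodMk_right 0
    · refine Continuous.prodMk (by fun_prop) ?_
      exact (hV w).1.comp_continuous (by fun_prop) hmem
  have hinv : ∀ v, g (1, meanVelocity φ T (x, v)) = (T, v) := by
    intro v
    have hm : Continuous fun s : unitInterval => meanVelocity φ (s * T) (x, v) :=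
      (hφ.contDiff_meanVelocity hk).continuous.comp
        ((continuous_subtype_val.mul continuous_const).prodMk continuous_const)
    have := congrFun (hsep.eq_of_comp_eq hhomeo.isLocallyInjective
      (g₁ := fun s : unitInterval => g (s, meanVelocity φ (s * T) (x, v)))
      (g₂ := fun s : unitInterval => ((s : ℝ) * T, v))
      (hg.comp (continuous_id.prodMk hm)) (by fun_prop)
      (funext fun s => Prod.ext rfl ((hV _).2.2 _ (hmem s))) 0
      (by simp [g, (hV _).2.1, hφ.meanVelocity_zero])) 1
    simpa using this
  constructor
  · intro v₁ v₂ h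
    simp only [hφ.fst_eq_add_smul_meanVelocity hk, add_right_inj] at h
    have h' := smul_right_injective _ hT.ne' h
    have := (hinv v₁).symm.trans ((congrArg (fun w => g (1, w)) h').trans (hinv v₂))
    exact congrArg Prod.snd this
  · intro y
    refine ⟨V (T⁻¹ • (y - x)) T, ?_⟩
    simp only [hφ.fst_eq_add_smul_meanVelocity hk, (hV _).2.2 T ⟨hT.le, le_rfl⟩]
    rw [smul_smul, mul_inv_cancel₀ hT.ne', one_smul, add_sub_cancel]

end ExponentialMap

section TwoPoint

variable {n : ℕ} {k : ℕ} {L : E n × E n → ℝ} {φ : ℝ → E n × E n → E n × E n}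

/-- Initial velocity of the orbit which goes from `x` to `y` in time `t`. -/
def shootingVelocity (φ : ℝ → E n × E n → E n × E n) (t : ℝ) (x y : E n) : E n :=
  Function.invFun (fun v => (φ t (x, v)).1) y

/-- Action of the orbit which goes from `x` to `y` in time `t`. -/
def twoPointAction (L : E n × E n → ℝ) (φ : ℝ → E n × E n → E n × E n) (t : ℝ) (x y : E n) : ℝ :=
  orbitAction L φ t (x, shootingVelocity φ t x y)

theorem IsELFlow.fst_shootingVelocity (hk : 2 ≤ k) (hL : IsTonelliLagrangian n (k : ℕ∞) L)
    (hφ : IsELFlow n k L φ) (hnc : NoConjugatePoints n φ) {t : ℝ} (ht : 0 < t) (x y : E n) :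
    (φ t (x, shootingVelocity φ t x y)).1 = y :=
  Function.rightInverse_invFun (hφ.bijective_fst hk hL hnc x ht).2 y

theorem IsELFlow.shootingVelocity_fst (hk : 2 ≤ k) (hL : IsTonelliLagrangian n (k : ℕ∞) L)
    (hφ : IsELFlow n k L φ) (hnc : NoConjugatePoints n φ) {t : ℝ} (ht : 0 < t) (x v : E n) :
    shootingVelocity φ t x (φ t (x, v)).1 = v :=
  Function.leftInverse_invFun (hφ.bijective_fst hk hL hnc x ht).1 v

theorem IsELFlow.contDiffAt_shootingVelocity (hk : 2 ≤ k)
    (hL : IsTonelliLagrangian n (k : ℕ∞) L) (hφ : IsELFlow n k L φ)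
    (hnc : NoConjugatePoints n φ) {t : ℝ} (ht : 0 < t) (x y : E n) :
    ContDiffAt ℝ ((k - 1 : ℕ) : ℕ∞)
      (fun p : ℝ × (E n × E n) => shootingVelocity φ p.1 p.2.1 p.2.2) (t, x, y) := by
  let F : ℝ × (E n × E n) → ℝ × (E n × E n) := fun p => (p.1, p.2.1, (φ p.1 p.2).1)
  have hF : ContDiff ℝ ((k - 1 : ℕ) : ℕ∞) F :=
    contDiff_fst.prodMk (contDiff_snd.fst.prodMk hφ.1.fst)
  have hm : (((k - 1 : ℕ) : ℕ∞) : WithTop ℕ∞) ≠ 0 := by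
    simp only [ne_eq, WithTop.coe_eq_zero, Nat.cast_eq_zero]; omega
  set v := shootingVelocity φ t x y with hv
  have hvy : (φ t (x, v)).1 = y := hφ.fst_shootingVelocity hk hL hnc ht x y
  have hinj : ∀ w, fderiv ℝ F (t, x, v) w = 0 → w = 0 := by
    rintro ⟨τ, ξ, η⟩ hw
    obtain ⟨A, hA, hA'⟩ := hφ.exists_hasFDerivAt_fst hk t (x, v)
    have hFd : HasFDerivAt F ((ContinuousLinearMap.fst ℝ ℝ (E n × E n)).prod
        (((ContinuousLinearMap.fst ℝ (E n) (E n)).comp (.snd ℝ ℝ (E n × E n))).prod A))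
        (t, x, v) :=
      hasFDerivAt_fst.prodMk (hasFDerivAt_snd.fst.prodMk hA)
    rw [hFd.fderiv] at hw
    simp only [ContinuousLinearMap.prod_apply, ContinuousLinearMap.coe_fst',
      ContinuousLinearMap.comp_apply, ContinuousLinearMap.coe_snd', Prod.mk_eq_zero, hA'] at hw
    obtain ⟨rfl, rfl, h⟩ := hw
    rw [zero_smul, zero_add] at h
    rw [hnc (x, v) t ht.ne' η h]
    rfl
  obtain ⟨e, he, heq, hed⟩ := exists_openPartialHomeomorph_of_fderiv_injective
    hF.contDiffAt hm hinj
  have hFv : F (t, x, v) = (t, x, y) := by simp only [F, hvy]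
  have hmem : (t, x, y) ∈ e.target := by
    rw [← hFv, ← heq]; exact e.map_source he
  rw [hFv] at hed
  refine hed.snd.snd.congr_of_eventuallyEq ?_
  filter_upwards [e.open_target.mem_nhds hmem,
    continuous_fst.continuousAt.preimage_mem_nhds (lt_mem_nhds ht)] with p hp hp0
  have h1 : F (e.symm p) = p := heq ▸ e.right_inv hp
  have h2 : (e.symm p).1 = p.1 := (Prod.ext_iff.1 h1).1
  have h3 : (e.symm p).2.1 = p.2.1 := (Prod.ext_iff.1 (Prod.ext_iff.1 h1).2).1
  have h4 : (φ (e.symm p).1 (e.symm p).2).1 = p.2.2 :=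
    (Prod.ext_iff.1 (Prod.ext_iff.1 h1).2).2
  have h5 := hφ.shootingVelocity_fst hk hL hnc hp0 (e.symm p).2.1 (e.symm p).2.2
  rwa [Prod.mk.eta, ← h2, h4, h2, h3] at h5

theorem IsELFlow.contDiff_shootingVelocity (hk : 2 ≤ k)
    (hL : IsTonelliLagrangian n (k : ℕ∞) L) (hφ : IsELFlow n k L φ)
    (hnc : NoConjugatePoints n φ) {t : ℝ} (ht : 0 < t) :
    ContDiff ℝ ((k - 1 : ℕ) : ℕ∞) (fun q : E n × E n => shootingVelocity φ t q.1 q.2) :=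
  contDiff_iff_contDiffAt.2 fun q =>
    (hφ.contDiffAt_shootingVelocity hk hL hnc ht q.1 q.2).comp q
      (contDiffAt_const.prodMk contDiffAt_id)

theorem one_le_natCast_sub_one (hk : 2 ≤ k) :
    (1 : WithTop ℕ∞) ≤ (((k - 1 : ℕ) : ℕ∞) : WithTop ℕ∞) := by
  exact_mod_cast (show 1 ≤ k - 1 by omega)

/-- The two-point action is a generating function of the flow. -/
theorem hasFDerivAt_twoPointAction (hk : 2 ≤ k) (hL : IsTonelliLagrangian n (k : ℕ∞) L)
    (hφ : IsELFlow n k L φ) (hnc : NoConjugatePoints n φ) {t : ℝ} (ht : 0 < t) (x y : E n) :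
    HasFDerivAt (fun q : E n × E n => twoPointAction L φ t q.1 q.2)
      ((partialV n L y (φ t (x, shootingVelocity φ t x y)).2).comp
          (ContinuousLinearMap.snd ℝ (E n) (E n)) -
        (partialV n L x (shootingVelocity φ t x y)).comp (ContinuousLinearMap.fst ℝ (E n) (E n)))
      (x, y) := by
  set v := shootingVelocity φ t x y with hv
  have hvy : (φ t (x, v)).1 = y := hφ.fst_shootingVelocity hk hL hnc ht x y
  have hV := ((hφ.contDiff_shootingVelocity hk hL hnc ht).differentiable
    (zero_lt_one.trans_le (one_le_natCast_sub_one hk)).ne' (x, y)).hasFDerivAt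
  have hg := (hasFDerivAt_fst (𝕜 := ℝ) (p := (x, y))).prodMk hV
  have hφd := (hφ.differentiable hk t (x, v)).hasFDerivAt
  have hend := (HasFDerivAt.comp (x, y) hφd hg).fst.unique
    ((hasFDerivAt_snd (𝕜 := ℝ) (p := (x, y))).congr_of_eventuallyEq
      (Eventually.of_forall fun q => hφ.fst_shootingVelocity hk hL hnc ht q.1 q.2))
  have hA := (hasFDerivAt_right_of_contDiff (contDiff_orbitAction hk hL hφ) t
    (x, v)).differentiableAt.hasFDerivAt
  refine (HasFDerivAt.comp (x, y) hA hg).congr_fderiv ?_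
  refine ContinuousLinearMap.ext fun ζ => ?_
  have h1 := congrArg (fun B => B ζ) hend
  have h2 := fderiv_orbitAction hk hL hφ t (x, v)
    (ζ.1, fderiv ℝ (fun q : E n × E n => shootingVelocity φ t q.1 q.2) (x, y) ζ)
  simp only [ContinuousLinearMap.comp_apply, ContinuousLinearMap.prod_apply,
    ContinuousLinearMap.coe_fst', ContinuousLinearMap.coe_snd'] at h1
  rw [h1, hvy] at h2
  exact h2

theorem shootingVelocity_add_intVec (hk : 2 ≤ k) (hL : IsTonelliLagrangian n (k : ℕ∞) L)
    (hφ : IsELFlow n k L φ) (hnc : NoConjugatePoints n φ) {t : ℝ} (ht : 0 < t) (x y : E n)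
    (m : Fin n → ℤ) :
    shootingVelocity φ t (x + intVec m) (y + intVec m) = shootingVelocity φ t x y := by
  have h := hφ.shootingVelocity_fst hk hL hnc ht (x + intVec m) (shootingVelocity φ t x y)
  rwa [hφ.apply_add_intVec hk hL, hφ.fst_shootingVelocity hk hL hnc ht] at h

theorem orbitAction_add_intVec (hk : 2 ≤ k) (hL : IsTonelliLagrangian n (k : ℕ∞) L)
    (hφ : IsELFlow n k L φ) (t : ℝ) (x v : E n) (m : Fin n → ℤ) :
    orbitAction L φ t (x + intVec m, v) = orbitAction L φ t (x, v) := by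
  simp only [orbitAction, hφ.apply_add_intVec hk hL, hL.periodic]

theorem twoPointAction_add_intVec (hk : 2 ≤ k) (hL : IsTonelliLagrangian n (k : ℕ∞) L)
    (hφ : IsELFlow n k L φ) (hnc : NoConjugatePoints n φ) {t : ℝ} (ht : 0 < t) (x y : E n)
    (m : Fin n → ℤ) :
    twoPointAction L φ t (x + intVec m) (y + intVec m) = twoPointAction L φ t x y := by
  rw [twoPointAction, shootingVelocity_add_intVec hk hL hφ hnc ht,
    orbitAction_add_intVec hk hL hφ, twoPointAction]

theorem twoPointAction_add_le (hk : 2 ≤ k) (hL : IsTonelliLagrangian n (k : ℕ∞) L)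
    (hφ : IsELFlow n k L φ) (hnc : NoConjugatePoints n φ) {s t : ℝ} (hs : 0 < s) (ht : 0 < t)
    (x y z : E n) :
    twoPointAction L φ (s + t) x z ≤ twoPointAction L φ s x y + twoPointAction L φ t y z := by
  set w := shootingVelocity φ t y z with hw
  let c : ℝ → E n := fun τ => (φ (τ - s) (y, w)).1
  have hc : ∀ τ, HasDerivAt c (φ (τ - s) (y, w)).2 τ := fun τ =>
    (hφ.hasDerivAt_fst (y, w) (τ - s)).comp_sub_const τ s
  have hcs : c s = y := by simp [c, hφ.2.1]
  have hct : c (s + t) = z := by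
    simp only [c, add_sub_cancel_left]; exact hφ.fst_shootingVelocity hk hL hnc ht y z
  have hv : ∀ τ, 0 < τ → DifferentiableAt ℝ (fun τ => shootingVelocity φ τ x (c τ)) τ := by
    intro τ hτ
    have h1 := (hφ.contDiffAt_shootingVelocity hk hL hnc hτ x (c τ)).differentiableAt
      (zero_lt_one.trans_le (one_le_natCast_sub_one hk)).ne'
    exact DifferentiableAt.comp τ h1 (differentiableAt_id.prodMk
      ((differentiableAt_const x).prodMk (hc τ).differentiableAt))
  have h := orbitAction_sub_le hk hL hφ (le_add_of_nonneg_right ht.le)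
    (fun τ hτ => (hv τ (hs.trans_le hτ.1)).continuousAt.continuousWithinAt)
    (fun τ hτ => hv τ (hs.trans hτ.1)) hc
    ((hφ.continuous_orbit hk (y, w)).snd.comp (continuous_id.sub continuous_const))
    (fun τ hτ => hφ.fst_shootingVelocity hk hL hnc (hs.trans hτ.1) x (c τ))
  simp only [hcs, hct] at h
  have h2 : ∫ τ in s..s + t, L (c τ, (φ (τ - s) (y, w)).2) = twoPointAction L φ t y z := by
    simp only [c, Prod.mk.eta]
    rw [intervalIntegral.integral_comp_sub_right (fun τ => L (φ τ (y, w)))]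
    simp [twoPointAction, orbitAction, hw]
  rw [h2] at h
  exact sub_le_iff_le_add'.1 h

theorem intVec_add (a b : Fin n → ℤ) : intVec (a + b) = intVec a + intVec b := by
  ext i; simp [intVec]

/-- Iterates of a point which is periodic up to the translation by `r`. -/
theorem IsELFlow.apply_nat_mul (hk : 2 ≤ k) (hL : IsTonelliLagrangian n (k : ℕ∞) L)
    (hφ : IsELFlow n k L φ) {T : ℝ} {r : Fin n → ℤ} {x v : E n}
    (h : φ T (x, v) = (x + intVec r, v)) (N : ℕ) :
    φ (N * T) (x, v) = (x + intVec (N • r), v) := by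
  induction N with
  | zero => ext i <;> simp [hφ.2.1, intVec]
  | succ N ih =>
    have h1 := hφ.apply_apply hk hL T (N * T) (x, v)
    rw [h, hφ.apply_add_intVec hk hL, ih] at h1
    rw [Nat.cast_succ, add_one_mul, ← h1, add_assoc, ← intVec_add, succ_nsmul]

theorem orbitAction_nat_mul (hk : 2 ≤ k) (hL : IsTonelliLagrangian n (k : ℕ∞) L)
    (hφ : IsELFlow n k L φ) {T : ℝ} {r : Fin n → ℤ} {x v : E n}
    (h : φ T (x, v) = (x + intVec r, v)) (N : ℕ) :
    orbitAction L φ (N * T) (x, v) = N * orbitAction L φ T (x, v) := by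
  have hc : Continuous fun s => L (φ s (x, v)) :=
    (hL.contDiff_two hk).continuous.comp (hφ.continuous_orbit hk (x, v))
  induction N with
  | zero => simp [orbitAction]
  | succ N ih =>
    have h1 : ∫ s in (N * T : ℝ)..((N + 1 : ℕ) * T : ℝ), L (φ s (x, v)) =
        orbitAction L φ T (x, v) := by
      have h2 : ∀ s, L (φ (s + N * T) (x, v)) = L (φ s (x, v)) := fun s => by
        rw [← hφ.apply_apply hk hL, hφ.apply_nat_mul hk hL h, hφ.apply_add_intVec hk hL,
          hL.periodic]
      have h3 := intervalIntegral.integral_comp_add_right (a := 0) (b := T)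
        (fun s => L (φ s (x, v))) (N * T : ℝ)
      simp only [h2] at h3
      rw [orbitAction, h3, zero_add, Nat.cast_succ, add_one_mul, add_comm T]
    rw [orbitAction, ← intervalIntegral.integral_add_adjacent_intervals
      (hc.intervalIntegrable _ _) (hc.intervalIntegrable _ _), h1, ← orbitAction, ih]
    push_cast; ring

end TwoPoint

section Subadditive

/-- A function squeezed between two functions which touch it at `y` and have the same
derivative at `y` is differentiable at `y`. -/
theorem hasFDerivAt_of_le_of_le {V : Type*} [NormedAddCommGroup V] [NormedSpace ℝ V]
    {f g u : V → ℝ} {A : V →L[ℝ] ℝ} {y : V} (hf : HasFDerivAt f A y) (hg : HasFDerivAt g A y)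
    (hfu : ∀ z, f z ≤ u z) (hug : ∀ z, u z ≤ g z) (hfy : f y = u y) (hgy : g y = u y) :
    HasFDerivAt u A y := by
  rw [hasFDerivAt_iff_isLittleO] at *
  refine (Asymptotics.IsBigO.of_norm_le fun z => ?_).trans_isLittleO
    (hf.norm_left.add hg.norm_left)
  have h1 := neg_abs_le (f z - f y - A (z - y))
  have h2 := le_abs_self (g z - g y - A (z - y))
  have h3 := abs_nonneg (f z - f y - A (z - y))
  have h4 := abs_nonneg (g z - g y - A (z - y))
  simp only [Real.norm_eq_abs]
  rw [abs_le]
  constructor <;> linarith [hfu z, hug z]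

/-- If the costs `F N` satisfy a triangle inequality, a point at which the diagonal cost is
exactly additive minimizes the diagonal cost. -/
theorem diag_le_of_subadditive {α : Type*} {F : ℕ → α → α → ℝ}
    (hF : ∀ N M x y z, F (N + M + 1) x z ≤ F N x y + F M y z) {a : α}
    (ha : ∀ N : ℕ, F N a a = (N + 1) * F 0 a a) (b : α) : F 0 a a ≤ F 0 b b := by
  have hb : ∀ N : ℕ, F N b b ≤ (N + 1) * F 0 b b := by
    intro N
    induction N with
    | zero => simp
    | succ N ih =>
      have := hF N 0 b b b
      push_cast
      rw [add_zero] at this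
      linarith
  by_contra! hlt
  obtain ⟨N, hN⟩ := exists_nat_gt
    ((F 0 a b + F 0 b a - 2 * F 0 a a - (F 0 a a - F 0 b b)) / (F 0 a a - F 0 b b))
  rw [div_lt_iff₀ (sub_pos.2 hlt)] at hN
  have h1 := hF 0 (N + 1) a b a
  have h2 := hF N 0 b b a
  rw [ha] at h1
  push_cast at h1
  rw [add_zero] at h2
  nlinarith [hb N]

/-- The common derivative on the diagonal of a subadditive family of costs is closed. -/
theorem fderiv_symmetric_of_subadditive {V : Type*} [NormedAddCommGroup V] [NormedSpace ℝ V]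
    {F : ℕ → V → V → ℝ} (hF : ∀ N M x y z, F (N + M + 1) x z ≤ F N x y + F M y z)
    (hdiag : ∀ N x, F N x x = 0) {P : V → V →L[ℝ] ℝ} (hP : Differentiable ℝ P)
    (hFP : ∀ y, HasFDerivAt (fun q : V × V => F 0 q.1 q.2)
      ((P y).comp (ContinuousLinearMap.snd ℝ V V) - (P y).comp (ContinuousLinearMap.fst ℝ V V))
      (y, y)) (y ξ η : V) : fderiv ℝ P y ξ η = fderiv ℝ P y η ξ := by
  let u : V → ℝ := fun z => ⨅ N, F N 0 z
  have hbdd : ∀ z, BddBelow (range fun N => F N 0 z) := fun z => by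
    refine ⟨-F 0 z 0, ?_⟩
    rintro _ ⟨N, rfl⟩
    have := hF N 0 0 z 0
    rw [hdiag] at this
    simp only
    linarith
  have hu : ∀ y z, u z ≤ u y + F 0 y z := fun y z => by
    rw [← sub_le_iff_le_add]
    refine le_ciInf fun N => ?_
    rw [sub_le_iff_le_add]
    exact (ciInf_le (hbdd z) _).trans (hF N 0 0 y z)
  have hud : ∀ y, HasFDerivAt u (P y) y := fun y => by
    have h1 := ((hFP y).comp y (hasFDerivAt_prodMk_right y y)).const_add (u y)
    have h2 := (HasFDerivAt.comp (f := fun z => (z, y)) y (hFP y)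
      (hasFDerivAt_prodMk_left y y)).const_sub (u y)
    refine hasFDerivAt_of_le_of_le (h2.congr_fderiv ?_) (h1.congr_fderiv ?_)
      (fun z => ?_) (fun z => ?_) ?_ ?_
    · ext; simp
    · ext; simp
    · have := hu z y
      simp only [Function.comp_apply]
      linarith
    · exact hu y z
    · simp [hdiag]
    · simp [hdiag]
  exact second_derivative_symmetric hud (hP y).hasFDerivAt ξ η

end Subadditive

section Periodic

variable {n : ℕ} {k : ℕ} {L : E n × E n → ℝ} {φ : ℝ → E n × E n → E n × E n}

/-- Initial velocity of the orbit from `x` to its translate by `r` in time `T`. -/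
def periodicField (φ : ℝ → E n × E n → E n × E n) (T : ℝ) (r : Fin n → ℤ) (x : E n) : E n :=
  shootingVelocity φ T x (x + intVec r)

/-- Action from `x` to the translate of `y` by `(N + 1) • r` in time `(N + 1) * T`. -/
def iteratedAction (L : E n × E n → ℝ) (φ : ℝ → E n × E n → E n × E n) (T : ℝ)
    (r : Fin n → ℤ) (N : ℕ) (x y : E n) : ℝ :=
  twoPointAction L φ ((N + 1 : ℕ) * T) x (y + intVec ((N + 1) • r))

theorem iteratedAction_zero (T : ℝ) (r : Fin n → ℤ) (x y : E n) :
    iteratedAction L φ T r 0 x y = twoPointAction L φ T x (y + intVec r) := by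
  simp [iteratedAction]

theorem iteratedAction_add_le (hk : 2 ≤ k) (hL : IsTonelliLagrangian n (k : ℕ∞) L)
    (hφ : IsELFlow n k L φ) (hnc : NoConjugatePoints n φ) {T : ℝ} (hT : 0 < T) (r : Fin n → ℤ)
    (N M : ℕ) (x y z : E n) :
    iteratedAction L φ T r (N + M + 1) x z ≤
      iteratedAction L φ T r N x y + iteratedAction L φ T r M y z := by
  have hpos : ∀ N : ℕ, 0 < ((N + 1 : ℕ) : ℝ) * T := fun N => by positivity
  have h := twoPointAction_add_le hk hL hφ hnc (hpos N) (hpos M) x (y + intVec ((N + 1) • r))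
    (z + intVec ((M + 1) • r) + intVec ((N + 1) • r))
  rw [twoPointAction_add_intVec hk hL hφ hnc (hpos M)] at h
  convert h using 2
  · rw [iteratedAction]
    congr 1
    · push_cast; ring
    · rw [add_assoc z, ← intVec_add, ← add_nsmul]
      congr 3; ring
  all_goals rfl

theorem hasFDerivAt_iteratedAction_zero (hk : 2 ≤ k) (hL : IsTonelliLagrangian n (k : ℕ∞) L)
    (hφ : IsELFlow n k L φ) (hnc : NoConjugatePoints n φ) {T : ℝ} (hT : 0 < T) (r : Fin n → ℤ)
    (x : E n) :
    HasFDerivAt (fun q : E n × E n => iteratedAction L φ T r 0 q.1 q.2)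
      ((partialV n L x (φ T (x, periodicField φ T r x)).2).comp
          (ContinuousLinearMap.snd ℝ (E n) (E n)) -
        (partialV n L x (periodicField φ T r x)).comp (ContinuousLinearMap.fst ℝ (E n) (E n)))
      (x, x) := by
  have h := hasFDerivAt_twoPointAction hk hL hφ hnc hT x (x + intVec r)
  rw [hL.partialV_add] at h
  simp only [iteratedAction_zero]
  exact HasFDerivAt.comp (x, x) h
    ((hasFDerivAt_fst (𝕜 := ℝ) (p := (x, x))).prodMk (hasFDerivAt_snd.add_const (intVec r)))

theorem hasFDerivAt_iteratedAction_diag (hk : 2 ≤ k) (hL : IsTonelliLagrangian n (k : ℕ∞) L)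
    (hφ : IsELFlow n k L φ) (hnc : NoConjugatePoints n φ) {T : ℝ} (hT : 0 < T) (r : Fin n → ℤ)
    (x : E n) :
    HasFDerivAt (fun x => iteratedAction L φ T r 0 x x)
      (partialV n L x (φ T (x, periodicField φ T r x)).2 -
        partialV n L x (periodicField φ T r x)) x :=
  (HasFDerivAt.comp (f := fun x => (x, x)) x (hasFDerivAt_iteratedAction_zero hk hL hφ hnc hT r x)
    ((hasFDerivAt_id x).prodMk (hasFDerivAt_id x))).congr_fderiv (by ext; simp)

theorem apply_periodicField_of_isLocalMax (hk : 2 ≤ k) (hL : IsTonelliLagrangian n (k : ℕ∞) L)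
    (hφ : IsELFlow n k L φ) (hnc : NoConjugatePoints n φ) {T : ℝ} (hT : 0 < T) (r : Fin n → ℤ)
    {x : E n} (hx : IsLocalMax (fun x => iteratedAction L φ T r 0 x x) x) :
    φ T (x, periodicField φ T r x) = (x + intVec r, periodicField φ T r x) := by
  have h := hx.hasFDerivAt_eq_zero (hasFDerivAt_iteratedAction_diag hk hL hφ hnc hT r x)
  exact Prod.ext (hφ.fst_shootingVelocity hk hL hnc hT _ _)
    (partialV_injective (hL.contDiff_two hk) hL.posdef x (sub_eq_zero.1 h))

theorem iteratedAction_diag_of_apply_eq (hk : 2 ≤ k) (hL : IsTonelliLagrangian n (k : ℕ∞) L)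
    (hφ : IsELFlow n k L φ) (hnc : NoConjugatePoints n φ) {T : ℝ} (hT : 0 < T) (r : Fin n → ℤ)
    {x : E n} (hx : φ T (x, periodicField φ T r x) = (x + intVec r, periodicField φ T r x))
    (N : ℕ) : iteratedAction L φ T r N x x = (N + 1) * iteratedAction L φ T r 0 x x := by
  have h := hφ.shootingVelocity_fst hk hL hnc (t := ((N + 1 : ℕ) : ℝ) * T) (by positivity) x
    (periodicField φ T r x)
  rw [hφ.apply_nat_mul hk hL hx] at h
  rw [iteratedAction_zero, iteratedAction, twoPointAction, h, orbitAction_nat_mul hk hL hφ hx]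
  push_cast; rfl

theorem iteratedAction_diag_eq (hk : 2 ≤ k) (hL : IsTonelliLagrangian n (k : ℕ∞) L)
    (hφ : IsELFlow n k L φ) (hnc : NoConjugatePoints n φ) {T : ℝ} (hT : 0 < T) (r : Fin n → ℤ)
    (x y : E n) : iteratedAction L φ T r 0 x x = iteratedAction L φ T r 0 y y := by
  obtain ⟨a, -, ha⟩ := (isCompact_Icc (a := (0 : E n)) (b := 1)).exists_isMaxOn
    (nonempty_Icc.2 zero_le_one) (f := fun x => iteratedAction L φ T r 0 x x)
    fun x _ => (hasFDerivAt_iteratedAction_diag hk hL hφ hnc hT r x).continuousAt.continuousWithinAt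
  have hmax : ∀ y, iteratedAction L φ T r 0 y y ≤ iteratedAction L φ T r 0 a a := by
    intro y
    obtain ⟨m, y', hy', rfl⟩ := exists_eq_add_intVec y
    refine le_of_eq_of_le ?_ (ha hy')
    simp only [iteratedAction_zero]
    rw [add_right_comm, twoPointAction_add_intVec hk hL hφ hnc hT]
  have hadd := iteratedAction_diag_of_apply_eq hk hL hφ hnc hT r
    (apply_periodicField_of_isLocalMax hk hL hφ hnc hT r (Eventually.of_forall hmax))
  have hmin : ∀ y, iteratedAction L φ T r 0 a a ≤ iteratedAction L φ T r 0 y y :=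
    diag_le_of_subadditive (iteratedAction_add_le hk hL hφ hnc hT r) hadd
  exact ((hmax x).antisymm (hmin x)).trans ((hmin y).antisymm (hmax y))

theorem apply_periodicField (hk : 2 ≤ k) (hL : IsTonelliLagrangian n (k : ℕ∞) L)
    (hφ : IsELFlow n k L φ) (hnc : NoConjugatePoints n φ) {T : ℝ} (hT : 0 < T) (r : Fin n → ℤ)
    (x : E n) : φ T (x, periodicField φ T r x) = (x + intVec r, periodicField φ T r x) :=
  apply_periodicField_of_isLocalMax hk hL hφ hnc hT r
    (Eventually.of_forall fun y => (iteratedAction_diag_eq hk hL hφ hnc hT r y x).le)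

theorem contDiff_periodicField (hk : 2 ≤ k) (hL : IsTonelliLagrangian n (k : ℕ∞) L)
    (hφ : IsELFlow n k L φ) (hnc : NoConjugatePoints n φ) {T : ℝ} (hT : 0 < T)
    (r : Fin n → ℤ) : ContDiff ℝ ((k - 1 : ℕ) : ℕ∞) (periodicField φ T r) :=
  (hφ.contDiff_shootingVelocity hk hL hnc hT).comp
    (contDiff_id.prodMk (contDiff_id.add contDiff_const))

theorem contDiff_partialV_periodicField (hk : 2 ≤ k) (hL : IsTonelliLagrangian n (k : ℕ∞) L)
    (hφ : IsELFlow n k L φ) (hnc : NoConjugatePoints n φ) {T : ℝ} (hT : 0 < T)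
    (r : Fin n → ℤ) : ContDiff ℝ 1 fun x => partialV n L x (periodicField φ T r x) :=
  (contDiff_partialV (hL.contDiff_two hk)).comp (contDiff_id.prodMk
    ((contDiff_periodicField hk hL hφ hnc hT r).of_le (one_le_natCast_sub_one hk)))

theorem fderiv_partialV_periodicField_symmetric (hk : 2 ≤ k)
    (hL : IsTonelliLagrangian n (k : ℕ∞) L) (hφ : IsELFlow n k L φ)
    (hnc : NoConjugatePoints n φ) {T : ℝ} (hT : 0 < T) (r : Fin n → ℤ) (x ξ η : E n) :
    fderiv ℝ (fun x => partialV n L x (periodicField φ T r x)) x ξ η =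
      fderiv ℝ (fun x => partialV n L x (periodicField φ T r x)) x η ξ := by
  set a := iteratedAction L φ T r 0 0 0
  refine fderiv_symmetric_of_subadditive
    (F := fun N x y => iteratedAction L φ T r N x y - (N + 1) * a) ?_ ?_
    ((contDiff_partialV_periodicField hk hL hφ hnc hT r).differentiable one_ne_zero) ?_ x ξ η
  · intro N M x y z
    have := iteratedAction_add_le hk hL hφ hnc hT r N M x y z
    push_cast
    linarith
  · intro N x
    rw [iteratedAction_diag_of_apply_eq hk hL hφ hnc hT r
      (apply_periodicField hk hL hφ hnc hT r x), iteratedAction_diag_eq hk hL hφ hnc hT r x 0,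
      sub_self]
  · intro y
    have h := hasFDerivAt_iteratedAction_zero hk hL hφ hnc hT r y
    rw [apply_periodicField hk hL hφ hnc hT r y] at h
    exact h.sub_const _

theorem periodicField_eq_of_isExtremal (hk : 2 ≤ k) (hL : IsTonelliLagrangian n (k : ℕ∞) L)
    (hφ : IsELFlow n k L φ) (hnc : NoConjugatePoints n φ) {T : ℝ} (hT : 0 < T) (r : Fin n → ℤ)
    {c : ℝ → E n} (hc : IsExtremal n L c) (hcT : c T = c 0 + intVec r) :
    deriv c 0 = periodicField φ T r (c 0) := by
  have h := hφ.shootingVelocity_fst hk hL hnc hT (c 0) (deriv c 0)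
  rw [hφ.apply_eq_of_isExtremal hk hL hc, hcT] at h
  exact h.symm

theorem snd_apply_periodicField (hk : 2 ≤ k) (hL : IsTonelliLagrangian n (k : ℕ∞) L)
    (hφ : IsELFlow n k L φ) (hnc : NoConjugatePoints n φ) {T : ℝ} (hT : 0 < T) (r : Fin n → ℤ)
    (x : E n) (t : ℝ) :
    (φ t (x, periodicField φ T r x)).2 =
      periodicField φ T r (φ t (x, periodicField φ T r x)).1 := by
  set z := φ t (x, periodicField φ T r x) with hz
  have h : φ T z = (z.1 + intVec r, z.2) := by
    rw [hz, hφ.apply_apply hk hL, add_comm, ← hφ.apply_apply hk hL,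
      apply_periodicField hk hL hφ hnc hT, hφ.apply_add_intVec hk hL]
  have h2 := hφ.shootingVelocity_fst hk hL hnc hT z.1 z.2
  rw [Prod.mk.eta, h] at h2
  exact h2.symm

end Periodic

end Auxiliary

/-- Construction of the totally periodic Lagrangian torus `Γ_{T,r}`:
through every point `x` there is a unique extremal curve with `c(s+T) = c(s) + r`; the
initial velocities define a `ℤⁿ`-periodic `C^{k-1}` vector field `X`; the action over a
period is independent of the point; the graph of `X` is flow-invariant and consists of
`T`-periodic points (shifted by `r`); and the Legendre image of the graph is Lagrangian
(symmetric Jacobian). -/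
theorem periodic_lagrangian_torus (n k : ℕ) (hn : 1 ≤ n) (hk : 2 ≤ k)
    (L : E n × E n → ℝ) (hL : IsTonelliLagrangian n (k : ℕ∞) L)
    (φ : ℝ → E n × E n → E n × E n) (hφ : IsELFlow n k L φ)
    (hnc : NoConjugatePoints n φ)
    (T : ℝ) (hT : 0 < T) (r : Fin n → ℤ) :
    ∃ X : E n → E n,
      -- (1) existence of the `(T, r)`-periodic extremal curve through each point
      (∀ x : E n, ∃ c : ℝ → E n, IsExtremal n L c ∧ c 0 = x ∧
        (∀ s : ℝ, c (s + T) = c s + intVec r) ∧ deriv c 0 = X x) ∧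
      -- (1') and its uniqueness
      (∀ (x : E n) (c c' : ℝ → E n), IsExtremal n L c → IsExtremal n L c' →
        c 0 = x → c' 0 = x → (∀ s : ℝ, c (s + T) = c s + intVec r) →
        (∀ s : ℝ, c' (s + T) = c' s + intVec r) → c = c') ∧
      -- (2) `X` is `ℤⁿ`-periodic and `C^{k-1}`
      (∀ (x : E n) (m : Fin n → ℤ), X (x + intVec m) = X x) ∧
      ContDiff ℝ ((k - 1 : ℕ) : ℕ∞) X ∧
      -- (3) the action over one period does not depend on the point
      (∀ x y : E n,
        (∫ s in (0:ℝ)..T, L (φ s (x, X x))) = ∫ s in (0:ℝ)..T, L (φ s (y, X y))) ∧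
      -- (4) the graph of `X` is invariant and made of `T`-periodic orbits of class `r`
      (∀ (x : E n) (t : ℝ), (φ t (x, X x)).2 = X ((φ t (x, X x)).1)) ∧
      (∀ x : E n, φ T (x, X x) = (x + intVec r, X x)) ∧
      -- (5) the Legendre image `x ↦ ∂L/∂v (x, X x)` has symmetric Jacobian (Lagrangian graph)
      (∀ (x : E n) (i j : Fin n),
        fderiv ℝ (fun x' => partialV n L x' (X x') (Pi.single i 1)) x (Pi.single j 1) =
        fderiv ℝ (fun x' => partialV n L x' (X x') (Pi.single j 1)) x (Pi.single i 1)) := by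
  refine ⟨periodicField φ T r, fun x => ?_, fun x c c' hc hc' hx hx' hper hper' => ?_,
    fun x m => ?_, contDiff_periodicField hk hL hφ hnc hT r, fun x y => ?_,
    snd_apply_periodicField hk hL hφ hnc hT r, apply_periodicField hk hL hφ hnc hT r,
    fun x i j => ?_⟩
  · obtain ⟨hext, hvel⟩ := hφ.2.2 x (periodicField φ T r x)
    refine ⟨_, hext, by simp only [hφ.2.1], fun s => ?_, ?_⟩
    · simp only [← hφ.apply_apply hk hL T s, apply_periodicField hk hL hφ hnc hT r,
        hφ.apply_add_intVec hk hL]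
    · rw [← hvel, hφ.2.1]
  · have hzero : ∀ c : ℝ → E n, (∀ s, c (s + T) = c s + intVec r) → c T = c 0 + intVec r :=
      fun c h => by simpa using h 0
    refine hc.eq_of_initial hk hL hc' (hx.trans hx'.symm) ?_
    rw [periodicField_eq_of_isExtremal hk hL hφ hnc hT r hc (hzero c hper),
      periodicField_eq_of_isExtremal hk hL hφ hnc hT r hc' (hzero c' hper'), hx, hx']
  · rw [periodicField, add_right_comm, shootingVelocity_add_intVec hk hL hφ hnc hT, periodicField]
  · have h := iteratedAction_diag_eq hk hL hφ hnc hT r x y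
    rwa [iteratedAction_zero, iteratedAction_zero] at h
  · have hP : HasFDerivAt (fun x => partialV n L x (periodicField φ T r x)) _ x :=
      ((contDiff_partialV_periodicField hk hL hφ hnc hT r).differentiable one_ne_zero
        x).hasFDerivAt
    rw [(hP.clm_apply (hasFDerivAt_const _ x)).fderiv,
      (hP.clm_apply (hasFDerivAt_const _ x)).fderiv]
    simpa using fderiv_partialV_periodicField_symmetric hk hL hφ hnc hT r x _ _

end
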